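/- Reduction to zero-dimensional systems: for all G-systems (X_i,G) (i=1,…,r) and factor maps π_i : X_i → X_{i+1} (i=1,…,r−1), there exist zero-dimensional G-systems (Z_i,G) (i=1,…,r) and factor maps Π_i : Z_i → Z_{i+1} (i=1,…,r−1) such that for every continuous function f : X_1 → ℝ there is a continuous function g : Z_1 → ℝ with P^a_var(f,G,π) ≥ P^a_var(g,G,Π) and P^a(f,G,π) ≤ P^a(g,G,Π), where π = (π_i)_i and Π = (Π_i)_i. -/

import Mathlib

open scoped BigOperators NNReal
open Filter

namespace WPP

variable (G : Type) [Group G]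

/-- `B(F,K) = {g ∈ G : Kg ∩ F ≠ ∅ and Kg ∩ (G∖F) ≠ ∅}`. -/
def folnerB (F K : Finset G) : Set G :=
  {g : G | (∃ k ∈ K, k * g ∈ F) ∧ ∃ k ∈ K, k * g ∉ F}

/-- A Følner sequence of `G`. -/
def IsFolner (F : ℕ → Finset G) : Prop :=
  (∀ n, (F n).Nonempty) ∧
    ∀ K : Finset G, K.Nonempty →
      Tendsto (fun n => ((folnerB G (F n) K).ncard : ℝ) / ((F n).card : ℝ)) atTop (nhds 0)

/-- A `G`-system: a compact metric space together with a continuous action of `G`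
by homeomorphisms. -/
structure GSystem where
  carrier : Type
  [metric : MetricSpace carrier]
  [cpt : CompactSpace carrier]
  act : G → carrier → carrier
  one_act : ∀ x, act 1 x = x
  mul_act : ∀ g h x, act (g * h) x = act g (act h x)
  cont_act : ∀ g, Continuous (act g)

attribute [instance] GSystem.metric GSystem.cpt

variable {G}

noncomputable instance (S : GSystem G) : MeasurableSpace S.carrier := borel S.carrier
instance (S : GSystem G) : BorelSpace S.carrier := ⟨rfl⟩

/-- A factor map between `G`-systems: a continuous equivariant surjection. -/
structure FactorMap (S T : GSystem G) where
  toFun : S.carrier → T.carrier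
  cont : Continuous toFun
  surj : Function.Surjective toFun
  equiv : ∀ g x, toFun (S.act g x) = T.act g (toFun x)

/-- The dynamical (Bowen) metric `d_F(x,y) = max_{g∈F} d(gx,gy)`. -/
noncomputable def dynDist (S : GSystem G) (F : Finset G) (x y : S.carrier) : ℝ :=
  ((F.sup fun g => nndist (S.act g x) (S.act g y) : ℝ≥0) : ℝ)

/-- `diam(U, d_F) < ε`. -/
def diamLT (S : GSystem G) (F : Finset G) (U : Set S.carrier) (ε : ℝ) : Prop :=
  ∀ x ∈ U, ∀ y ∈ U, dynDist S F x y < ε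

/-- The Birkhoff-type sum `S_F f(x) = Σ_{g∈F} f(gx)`. -/
noncomputable def birk (S : GSystem G) (f : S.carrier → ℝ) (F : Finset G) (x : S.carrier) : ℝ :=
  ∑ g ∈ F, f (S.act g x)

variable (X : ℕ → GSystem G) (π : ∀ i, FactorMap (X i) (X (i + 1)))

/-- The recursively defined weighted quantities `P^a_{i+1}(Ω, f, F, ε)` (0-indexed: `wP … i`
corresponds to the paper's `P^a_{i+1}`, and `a i` to the paper's `a_{i+1}`). -/
noncomputable def wP (a : ℕ → ℝ) (f : (X 0).carrier → ℝ) (F : Finset G) (ε : ℝ) :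
    (i : ℕ) → Set (X i).carrier → ℝ
  | 0, Ω => sInf {s | ∃ (n : ℕ) (U : Fin n → Set (X 0).carrier),
      (∀ j, IsOpen (U j)) ∧ (Ω ⊆ ⋃ j, U j) ∧ (∀ j, diamLT (X 0) F (U j) ε) ∧
      s = ∑ j, Real.exp (sSup (birk (X 0) f F '' U j))}
  | i + 1, Ω => sInf {s | ∃ (n : ℕ) (U : Fin n → Set (X (i + 1)).carrier),
      (∀ j, IsOpen (U j)) ∧ (Ω ⊆ ⋃ j, U j) ∧ (∀ j, diamLT (X (i + 1)) F (U j) ε) ∧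
      s = ∑ j, (wP a f F ε i ((π i).toFun ⁻¹' U j)) ^ (a i)}

/-- `lim_n log P^a_r(X_r, f, F_n, ε) / |F_n|` (realized as a `limsup` in `EReal`; by the
Ornstein–Weiss lemma the limit exists, so this is the limit). -/
noncomputable def pressEps (r : ℕ) (a : ℕ → ℝ) (f : (X 0).carrier → ℝ)
    (Fn : ℕ → Finset G) (ε : ℝ) : EReal :=
  limsup (fun n =>
    ((Real.log (wP X π a f (Fn n) ε (r - 1) Set.univ) / ((Fn n).card : ℝ) : ℝ) : EReal)) atTop

/-- The `a`-weighted topological pressure `P^a(f,G) = lim_{ε→0} P^a(X_r,f,ε)`; since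
`P^a(X_r,f,ε)` is non-decreasing as `ε` decreases, the limit equals the supremum over `ε > 0`. -/
noncomputable def press (r : ℕ) (a : ℕ → ℝ) (f : (X 0).carrier → ℝ)
    (Fn : ℕ → Finset G) : EReal :=
  ⨆ (ε : ℝ) (_ : 0 < ε), pressEps X π r a f Fn ε

/-- Entropy `H_μ(p)` of a countable partition given by the fibers of `p`. -/
noncomputable def Hpart {Y : Type} [MeasurableSpace Y] {ι : Type}
    (μ : MeasureTheory.Measure Y) (p : Y → ι) : ℝ :=
  ∑' i : ι, Real.negMulLog ((μ (p ⁻¹' {i})).toReal)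

/-- `h_μ(p, G) = lim_n H_μ(p_{F_n})/|F_n|` (realized as a `limsup`, which equals the limit
since the limit exists). -/
noncomputable def hSeq (S : GSystem G) (Fn : ℕ → Finset G)
    (μ : MeasureTheory.Measure S.carrier) (p : S.carrier → ℕ) : ℝ :=
  limsup (fun n =>
    Hpart μ (fun x => fun g : (Fn n : Finset G) => p (S.act (g : G) x)) / ((Fn n).card : ℝ)) atTop

/-- The measure-theoretic entropy `h_μ(X,G)`: supremum of `h_μ(α,G)` over all finite
measurable partitions (encoded as measurable maps to `ℕ` with finite range). -/
noncomputable def mEnt (S : GSystem G) (Fn : ℕ → Finset G)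
    (μ : MeasureTheory.Measure S.carrier) : EReal :=
  ⨆ p : {p : S.carrier → ℕ // Measurable p ∧ (Set.range p).Finite},
    ((hSeq S Fn μ p.1 : ℝ) : EReal)

/-- `μ ∈ M^G(X)`: a `G`-invariant Borel probability measure. -/
def IsInvProb (S : GSystem G) (μ : MeasureTheory.Measure S.carrier) : Prop :=
  MeasureTheory.IsProbabilityMeasure μ ∧ ∀ g : G, μ.map (S.act g) = μ

/-- `π^{(i)} = π_i ∘ ⋯ ∘ π_1 : X_1 → X_{i+1}` (0-indexed). -/
noncomputable def chainMap : (i : ℕ) → (X 0).carrier → (X i).carrier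
  | 0 => id
  | i + 1 => (π i).toFun ∘ chainMap i

/-- The weights `w_1 = a_1⋯a_{r−1}`, `w_i = (1−a_{i−1})a_i⋯a_{r−1}`, `w_r = 1−a_{r−1}`
(0-indexed: `wt a r i` is the paper's `w_{i+1}`, `a j` the paper's `a_{j+1}`). -/
noncomputable def wt (a : ℕ → ℝ) (r i : ℕ) : ℝ :=
  if i = 0 then ∏ j ∈ Finset.range (r - 1), a j
  else (1 - a (i - 1)) * ∏ j ∈ Finset.Ico i (r - 1), a j

/-- `Σ_{i=1}^r w_i h_{μ_i}(X_i,G) + w_1 ∫ f dμ`. -/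
noncomputable def wSum (r : ℕ) (a : ℕ → ℝ) (Fn : ℕ → Finset G) (f : (X 0).carrier → ℝ)
    (μ : MeasureTheory.Measure (X 0).carrier) : EReal :=
  (∑ i ∈ Finset.range r, ((wt a r i : ℝ) : EReal) * mEnt (X i) Fn (μ.map (chainMap X π i)))
    + (((wt a r 0) * ∫ x, f x ∂μ : ℝ) : EReal)

/-- `P^a_var(f,G) = sup_{μ ∈ M^G(X_1)} ( Σ w_i h_{μ_i}(X_i,G) + w_1 ∫ f dμ )`. -/
noncomputable def Pvar (r : ℕ) (a : ℕ → ℝ) (Fn : ℕ → Finset G)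
    (f : (X 0).carrier → ℝ) : EReal :=
  ⨆ μ : {μ : MeasureTheory.Measure (X 0).carrier // IsInvProb (X 0) μ},
    wSum X π r a Fn f μ.1

end WPP

namespace WPP

section Marker

open scoped Pointwise

variable {G : Type} [Group G]

open Classical in
/-- The greedy marker configuration associated with a priority function `κ`. -/
noncomputable def greedy (D R : Finset G) (κ : G → ℕ) (g : G) : ℕ :=
  if ∃ v : {v // v ∈ D ∧ κ (v * g) < κ g}, greedy D R κ (v.1 * g) ≠ 0 then 0
  else sInf {j | j ≠ 0 ∧ ∀ r : {r // r ∈ R ∧ κ (r * g) < κ g}, greedy D R κ (r.1 * g) ≠ j}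
termination_by κ g
decreasing_by
  · exact v.2.2
  · exact r.2.2

open Classical in
theorem greedy_eq (D R : Finset G) (κ : G → ℕ) (g : G) :
    greedy D R κ g = if ∃ v ∈ D, κ (v * g) < κ g ∧ greedy D R κ (v * g) ≠ 0 then 0
      else sInf {j | j ≠ 0 ∧ ∀ r ∈ R, κ (r * g) < κ g → greedy D R κ (r * g) ≠ j} := by
  rw [greedy]
  simp only [Subtype.exists, Subtype.forall, exists_prop, and_assoc, and_imp]

theorem exists_fresh_label {G : Type} (R : Finset G) (w : G → ℕ) :
    ∃ j, j ≠ 0 ∧ j ≤ R.card + 1 ∧ ∀ r ∈ R, w r ≠ j := by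
  classical
  have : ((Finset.Icc 1 (R.card + 1)) \ R.image w).Nonempty := by
    rw [← Finset.card_pos]
    have h1 := Finset.le_card_sdiff (R.image w) (Finset.Icc 1 (R.card + 1))
    have h2 : (R.image w).card ≤ R.card := Finset.card_image_le
    simp only [Nat.card_Icc] at h1
    omega
  obtain ⟨j, hj⟩ := this
  simp only [Finset.mem_sdiff, Finset.mem_Icc, Finset.mem_image, not_exists, not_and] at hj
  exact ⟨j, by omega, hj.1.2, hj.2⟩

theorem greedy_zero_or (D R : Finset G) (κ : G → ℕ) (g : G) :
    (greedy D R κ g = 0 ∧ ∃ v ∈ D, κ (v * g) < κ g ∧ greedy D R κ (v * g) ≠ 0) ∨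
    (greedy D R κ g ≠ 0 ∧ greedy D R κ g ≤ R.card + 1 ∧
      (∀ v ∈ D, κ (v * g) < κ g → greedy D R κ (v * g) = 0) ∧
      ∀ r ∈ R, κ (r * g) < κ g → greedy D R κ (r * g) ≠ greedy D R κ g) := by
  by_cases h : ∃ v ∈ D, κ (v * g) < κ g ∧ greedy D R κ (v * g) ≠ 0
  · left
    obtain ⟨v, hv, h1, h2⟩ := h
    refine ⟨?_, v, hv, h1, h2⟩
    rw [greedy_eq, if_pos ⟨v, hv, h1, h2⟩]
  · right
    have hg : greedy D R κ g =
        sInf {j | j ≠ 0 ∧ ∀ r ∈ R, κ (r * g) < κ g → greedy D R κ (r * g) ≠ j} := by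
      rw [greedy_eq, if_neg h]
    obtain ⟨j, hj0, hj1, hj2⟩ := exists_fresh_label R (fun r => greedy D R κ (r * g))
    have hmem : j ∈ {j | j ≠ 0 ∧ ∀ r ∈ R, κ (r * g) < κ g → greedy D R κ (r * g) ≠ j} :=
      ⟨hj0, fun r hr _ => hj2 r hr⟩
    have h1 := Nat.sInf_mem ⟨j, hmem⟩
    have h2 := Nat.sInf_le hmem
    rw [← hg] at h1 h2
    refine ⟨h1.1, h2.trans hj1, ?_, fun r hr hk => h1.2 r hr hk⟩
    intro v hv hk
    by_contra h0
    exact h ⟨v, hv, hk, h0⟩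

theorem greedy_le (D R : Finset G) (κ : G → ℕ) (g : G) : greedy D R κ g ≤ R.card + 1 := by
  rcases greedy_zero_or D R κ g with h | h
  · omega
  · exact h.2.1

theorem greedy_sep {D R : Finset G} {κ : G → ℕ} (hD : ∀ v ∈ D, v⁻¹ ∈ D)
    (hκ : ∀ v ∈ D, v ≠ 1 → ∀ g, κ (v * g) ≠ κ g) {v g : G} (hv : v ∈ D)
    (h1 : greedy D R κ g ≠ 0) (h2 : greedy D R κ (v * g) ≠ 0) : v = 1 := by
  by_contra hv1
  rcases lt_or_gt_of_ne (hκ v hv hv1 g) with h | h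
  · rcases greedy_zero_or D R κ g with h' | h'
    · exact h1 h'.1
    · exact h2 (h'.2.2.1 v hv h)
  · rcases greedy_zero_or D R κ (v * g) with h' | h'
    · exact h2 h'.1
    · exact h1 (by simpa using h'.2.2.1 v⁻¹ (hD v hv) (by simpa using h))

theorem greedy_cov {D R : Finset G} {κ : G → ℕ} (h1 : 1 ∈ D) (g : G) :
    ∃ v ∈ D, greedy D R κ (v * g) ≠ 0 := by
  rcases greedy_zero_or D R κ g with h | h
  · obtain ⟨v, hv, _, h2⟩ := h.2
    exact ⟨v, hv, h2⟩
  · exact ⟨1, h1, by simpa using h.1⟩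

theorem greedy_ids {D R : Finset G} {κ : G → ℕ} (hR : ∀ v ∈ R, v⁻¹ ∈ R)
    (hκ : ∀ v ∈ R, v ≠ 1 → ∀ g, κ (v * g) ≠ κ g) {r g : G} (hr : r ∈ R)
    (h1 : greedy D R κ g ≠ 0) (h2 : greedy D R κ (r * g) = greedy D R κ g) : r = 1 := by
  by_contra hr1
  rcases lt_or_gt_of_ne (hκ r hr hr1 g) with h | h
  · rcases greedy_zero_or D R κ g with h' | h'
    · exact h1 h'.1
    · exact h'.2.2.2 r hr h h2
  · rcases greedy_zero_or D R κ (r * g) with h' | h'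
    · exact h1 (h2 ▸ h'.1)
    · exact h'.2.2.2 r⁻¹ (hR r hr) (by simpa using h) (by simpa using h2.symm)

theorem greedy_local [DecidableEq G] {D R : Finset G} (hDR : D ⊆ R) (h1 : 1 ∈ R)
    {κ κ' : G → ℕ} (n : ℕ) : ∀ g g' : G, κ g < n →
    (∀ w ∈ R ^ n, κ (w * g) = κ' (w * g')) → greedy D R κ g = greedy D R κ' g' := by
  induction n with
  | zero => intro g g' h; omega
  | succ n ih =>
    intro g g' hg hw
    have h1n : (1 : G) ∈ R ^ n := Finset.one_mem_pow h1
    have hgg : κ g = κ' g' := by simpa using hw 1 (Finset.one_mem_pow h1)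
    have hR : ∀ r ∈ R, κ (r * g) = κ' (r * g') := fun r hr => hw r (by
      rw [pow_succ]; simpa using Finset.mul_mem_mul h1n hr)
    have key : ∀ r ∈ R, κ (r * g) < κ g →
        greedy D R κ (r * g) = greedy D R κ' (r * g') := by
      intro r hr hk
      refine ih _ _ (by omega) fun w hwn => ?_
      rw [← mul_assoc, ← mul_assoc]
      exact hw _ (by rw [pow_succ]; exact Finset.mul_mem_mul hwn hr)
    have e1 : (∃ v ∈ D, κ (v * g) < κ g ∧ greedy D R κ (v * g) ≠ 0) ↔
        ∃ v ∈ D, κ' (v * g') < κ' g' ∧ greedy D R κ' (v * g') ≠ 0 := by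
      refine exists_congr fun v => and_congr_right fun hv => ?_
      rw [← hgg, ← hR v (hDR hv)]
      exact and_congr_right fun hk => by rw [key v (hDR hv) hk]
    have e2 : {j | j ≠ 0 ∧ ∀ r ∈ R, κ (r * g) < κ g → greedy D R κ (r * g) ≠ j} =
        {j | j ≠ 0 ∧ ∀ r ∈ R, κ' (r * g') < κ' g' → greedy D R κ' (r * g') ≠ j} := by
      ext j
      refine and_congr_right fun _ => forall_congr' fun r => forall_congr' fun hr => ?_
      rw [← hgg, ← hR r hr]
      exact forall_congr' fun hk => by rw [key r hr hk]
    rw [greedy_eq, greedy_eq, e2]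
    simp only [e1]

end Marker

section Level

open scoped Pointwise

open Classical in
/-- An equivariant choice of an element of a set of translations. -/
noncomputable def sel {G : Type} [One G] (A : Set G) : G := if h : A.Nonempty then h.some else 1

theorem sel_mem {G : Type} [One G] {A : Set G} (h : A.Nonempty) : sel A ∈ A := by
  rw [sel, dif_pos h]; exact h.some_mem

variable {G : Type} [Group G]

/-- The translation leading from `g` to the marker selected for it. -/
noncomputable def csel (D : Finset G) (ω : G → ℕ) (g : G) : G := sel {v | v ∈ D ∧ ω (v * g) ≠ 0}

theorem csel_mem {D : Finset G} {ω : G → ℕ} {g : G} (h : ∃ v ∈ D, ω (v * g) ≠ 0) :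
    csel D ω g ∈ D ∧ ω (csel D ω g * g) ≠ 0 :=
  sel_mem (A := {v | v ∈ D ∧ ω (v * g) ≠ 0}) h

theorem csel_mem_of_one {D : Finset G} (h1 : 1 ∈ D) (ω : G → ℕ) (g : G) : csel D ω g ∈ D := by
  by_cases h : ∃ v ∈ D, ω (v * g) ≠ 0
  · exact (csel_mem h).1
  · rw [csel, sel, dif_neg]
    · exact h1
    · exact h

theorem csel_congr {D : Finset G} {ω ω' : G → ℕ} {g g' : G}
    (h : ∀ v ∈ D, ω (v * g) = ω' (v * g')) : csel D ω g = csel D ω' g' := by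
  unfold csel
  congr 1
  ext v
  exact and_congr_right fun hv => by rw [h v hv]

/-- Parameters of one level of the quantization scheme: a tile shape, a range on which marker
labels are distinct, and a mesh. -/
structure Lev (G : Type) where
  U : Finset G
  R : Finset G
  γ : ℝ

variable [DecidableEq G]

namespace Lev

variable (ℓ : Lev G)

/-- The symmetric window `U⁻¹U`. -/
def D : Finset G := ℓ.U⁻¹ * ℓ.U
/-- The number of offsets available on a tile. -/
def M : ℕ := ℓ.D.card + 1
/-- The largest marker label. -/
def q : ℕ := ℓ.R.card + 1
/-- The relative distance kept from the boundaries of the mesh. -/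
noncomputable def θ : ℝ := 1 / (4 * (ℓ.M : ℝ))
/-- The offsets of the mesh. -/
noncomputable def t (m : ℕ) : ℝ := ℓ.γ * m / (ℓ.M : ℝ)

/-- The nondegeneracy conditions on a level. -/
structure Good : Prop where
  U_ne : ℓ.U.Nonempty
  R_inv : ∀ r ∈ ℓ.R, r⁻¹ ∈ ℓ.R
  D_sub : ℓ.D ⊆ ℓ.R
  γ_pos : 0 < ℓ.γ

variable {ℓ}

theorem M_pos : (0 : ℝ) < ℓ.M := by unfold M; positivity

theorem θ_pos : 0 < ℓ.θ := by have := ℓ.M_pos; unfold θ; positivity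

theorem D_inv {v : G} (hv : v ∈ ℓ.D) : v⁻¹ ∈ ℓ.D := by
  have h : ℓ.D⁻¹ = ℓ.D := by rw [D, mul_inv_rev, inv_inv]
  exact h ▸ Finset.inv_mem_inv hv

theorem Good.one_mem (h : ℓ.Good) : (1 : G) ∈ ℓ.D := by
  obtain ⟨u, hu⟩ := h.U_ne
  have := Finset.mul_mem_mul (Finset.inv_mem_inv hu) hu
  rwa [inv_mul_cancel] at this

theorem t_nonneg (hℓ : ℓ.Good) (m : ℕ) : 0 ≤ ℓ.t m := by
  have := hℓ.γ_pos
  unfold t; positivity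

theorem t_lt (hℓ : ℓ.Good) {m : ℕ} (hm : m < ℓ.M) : ℓ.t m < ℓ.γ := by
  have h := hℓ.γ_pos
  unfold t
  rw [div_lt_iff₀ ℓ.M_pos]
  have : (m : ℝ) < ℓ.M := by exact_mod_cast hm
  gcongr

/-- `a` is an admissible marker-and-quantization datum for `x` at the level `ℓ`. -/
structure Valid (ℓ : Lev G) (x : G → ℝ) (a : G → ℕ × ℤ) : Prop where
  le : ∀ g, (a g).1 ≤ ℓ.q
  sep : ∀ v ∈ ℓ.D, ∀ g, (a g).1 ≠ 0 → (a (v * g)).1 ≠ 0 → v = 1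
  cov : ∀ g, ∃ v ∈ ℓ.D, (a (v * g)).1 ≠ 0
  ids : ∀ r ∈ ℓ.R, ∀ g, (a g).1 ≠ 0 → (a (r * g)).1 = (a g).1 → r = 1
  disc : ∀ p, ∃ m < ℓ.M, ∀ g, csel ℓ.D (fun g => (a g).1) g * g = p →
    ((a g).2 + ℓ.θ) * ℓ.γ ≤ x g - ℓ.t m ∧ x g - ℓ.t m ≤ ((a g).2 + 1 - ℓ.θ) * ℓ.γ

theorem Valid.accuracy (hℓ : ℓ.Good) {x : G → ℝ} {a : G → ℕ × ℤ} (h : ℓ.Valid x a) (g : G) :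
    |x g - (a g).2 * ℓ.γ| ≤ 2 * ℓ.γ := by
  obtain ⟨m, hm, h'⟩ := h.disc (csel ℓ.D (fun g => (a g).1) g * g)
  obtain ⟨h1, h2⟩ := h' g rfl
  have h3 := t_nonneg hℓ m
  have h4 := t_lt hℓ hm
  have h5 : 0 < ℓ.θ * ℓ.γ := mul_pos θ_pos hℓ.γ_pos
  rw [abs_le]
  constructor <;> nlinarith

theorem Valid.shift {x : G → ℝ} {a : G → ℕ × ℤ} (h : ℓ.Valid x a) (k : G) :
    ℓ.Valid (fun g => x (g * k)) (fun g => a (g * k)) where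
  le g := h.le _
  sep v hv g h1 h2 := h.sep v hv (g * k) h1 (by simpa [mul_assoc] using h2)
  cov g := by simpa [mul_assoc] using h.cov (g * k)
  ids v hv g h1 h2 := h.ids v hv (g * k) h1 (by simpa [mul_assoc] using h2)
  disc p := by
    obtain ⟨m, hm, h'⟩ := h.disc (p * k)
    refine ⟨m, hm, fun g hg => h' (g * k) ?_⟩
    rw [← hg, mul_assoc]
    congr 1
    refine csel_congr fun v _ => ?_
    simp [mul_assoc]

/-- The value `y` is far from the boundary of the mesh with offset `m`. -/
def GoodOffset (ℓ : Lev G) (m : ℕ) (y : ℝ) : Prop :=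
  2 * ℓ.θ ≤ Int.fract ((y - ℓ.t m) / ℓ.γ) ∧ Int.fract ((y - ℓ.t m) / ℓ.γ) ≤ 1 - 2 * ℓ.θ

theorem bad_offset_unique (hℓ : ℓ.Good) {y : ℝ} {m m' : ℕ} (hm : m < ℓ.M) (hm' : m' < ℓ.M)
    (h : ¬ ℓ.GoodOffset m y) (h' : ¬ ℓ.GoodOffset m' y) : m = m' := by
  have hM := ℓ.M_pos
  have hγ := hℓ.γ_pos
  have key : ∀ m, ¬ ℓ.GoodOffset m y → ∃ i : ℤ, |y / ℓ.γ * ℓ.M - m - i * ℓ.M| < 1 / 2 := by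
    intro m h
    set z := (y - ℓ.t m) / ℓ.γ with hz
    have hz' : z * ℓ.M = y / ℓ.γ * ℓ.M - m := by
      rw [hz, t]; field_simp
    have hθ : 2 * ℓ.θ * ℓ.M = 1 / 2 := by unfold θ; field_simp; norm_num
    have hf := Int.fract_add_floor z
    have hf0 := Int.fract_nonneg z
    have hf1 := Int.fract_lt_one z
    rw [GoodOffset, not_and_or, not_le, not_le] at h
    rcases h with h | h
    · refine ⟨⌊z⌋, ?_⟩
      rw [← hz', ← sub_mul, show z - ⌊z⌋ = Int.fract z from rfl, abs_of_nonneg (by positivity), ← hθ]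
      gcongr
    · refine ⟨⌊z⌋ + 1, ?_⟩
      have : z - (⌊z⌋ + 1 : ℤ) = Int.fract z - 1 := by push_cast; linarith
      rw [← hz', ← sub_mul, this, abs_mul, abs_of_pos hM, abs_of_neg (by linarith), ← hθ]
      gcongr
      linarith
  obtain ⟨i, hi⟩ := key m h
  obtain ⟨j, hj⟩ := key m' h'
  have h1 : |((m' : ℤ) - m + (j - i) * ℓ.M : ℤ)| < 1 := by
    have : |((m' : ℝ) - m + (j - i) * ℓ.M)| < 1 := by
      rw [abs_lt] at *
      constructor <;> linarith
    exact_mod_cast this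
  have h2 : (m' : ℤ) - m + (j - i) * ℓ.M = 0 := Int.abs_lt_one_iff.1 h1
  have h3 : (ℓ.M : ℤ) ∣ (m' : ℤ) - m := ⟨i - j, by linarith⟩
  have h4 := Int.eq_zero_of_abs_lt_dvd h3 (by rw [abs_lt]; omega)
  omega

theorem exists_goodOffset (hℓ : ℓ.Good) (y : G → ℝ) :
    ∃ m < ℓ.M, ∀ v ∈ ℓ.D, ℓ.GoodOffset m (y v) := by
  by_contra! h
  choose f hf using fun m : Fin ℓ.M => h m m.2
  have := Finset.card_le_card_of_injOn (s := Finset.univ) (t := ℓ.D) f (fun m _ => (hf m).1) (by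
    intro m _ m' _ hmm
    have h1 := (hf m).2
    rw [hmm] at h1
    exact Fin.ext (bad_offset_unique hℓ m.2 m'.2 h1 (hf m').2))
  rw [Finset.card_univ, Fintype.card_fin, M] at this
  omega

/-- The offset chosen on the tile centred at `p`. -/
noncomputable def offset (ℓ : Lev G) (y : G → ℝ) (p : G) : ℕ :=
  sInf {m | ∀ v ∈ ℓ.D, ℓ.GoodOffset m (y (v * p))}

theorem offset_spec (hℓ : ℓ.Good) (y : G → ℝ) (p : G) :
    ℓ.offset y p < ℓ.M ∧ ∀ v ∈ ℓ.D, ℓ.GoodOffset (ℓ.offset y p) (y (v * p)) := by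
  obtain ⟨m, hm, h⟩ := exists_goodOffset hℓ (fun v => y (v * p))
  have hmem : m ∈ {m | ∀ v ∈ ℓ.D, ℓ.GoodOffset m (y (v * p))} := h
  exact ⟨(Nat.sInf_le hmem).trans_lt hm, Nat.sInf_mem ⟨m, hmem⟩⟩

/-- Greedy markers from priorities `κ`, together with the quantization of `y`. -/
noncomputable def decode (ℓ : Lev G) (κ : G → ℕ) (y : G → ℝ) (g : G) : ℕ × ℤ :=
  (greedy ℓ.D ℓ.R κ g,
    ⌊(y g - ℓ.t (ℓ.offset y (csel ℓ.D (greedy ℓ.D ℓ.R κ) g * g))) / ℓ.γ⌋)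

theorem decode_valid (hℓ : ℓ.Good) {κ : G → ℕ} (hκ : ∀ v ∈ ℓ.R, v ≠ 1 → ∀ g, κ (v * g) ≠ κ g)
    {x y : G → ℝ} (hxy : ∀ g, |y g - x g| ≤ ℓ.θ * ℓ.γ) : ℓ.Valid x (ℓ.decode κ y) where
  le g := greedy_le _ _ _ _
  sep v hv g h1 h2 := greedy_sep (fun v hv => D_inv hv) (fun v hv => hκ v (hℓ.D_sub hv)) hv h1 h2
  cov g := greedy_cov hℓ.one_mem g
  ids r hr g h1 h2 := greedy_ids hℓ.R_inv hκ hr h1 h2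
  disc p := by
    have hγ := hℓ.γ_pos
    obtain ⟨hm, h⟩ := offset_spec hℓ y p
    refine ⟨ℓ.offset y p, hm, fun g hg => ?_⟩
    have hg' : csel ℓ.D (greedy ℓ.D ℓ.R κ) g * g = p := hg
    have hc := (csel_mem (greedy_cov (R := ℓ.R) (κ := κ) hℓ.one_mem g)).1
    obtain ⟨h1, h2⟩ := h _ (D_inv hc)
    rw [← hg', inv_mul_cancel_left, hg'] at h1 h2
    have e : ((ℓ.decode κ y g).2 : ℝ) = ⌊(y g - ℓ.t (ℓ.offset y p)) / ℓ.γ⌋ := by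
      rw [decode, hg']
    rw [e]
    have hf := Int.fract_add_floor ((y g - ℓ.t (ℓ.offset y p)) / ℓ.γ)
    have hxy' := abs_le.1 (hxy g)
    set z := (y g - ℓ.t (ℓ.offset y p)) / ℓ.γ with hz
    have hzy : z * ℓ.γ = y g - ℓ.t (ℓ.offset y p) := by rw [hz]; field_simp
    constructor <;> nlinarith

end Lev
end Level

section Count

/-- Codes in a finite set may be replaced by natural numbers below its cardinality. -/
theorem exists_nat_code {Z β : Type} (H : Finset β) (c : Z → β) :
    ∃ code : Z → ℕ, (∀ z, c z ∈ H → code z < H.card) ∧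
      ∀ z z', c z ∈ H → c z' ∈ H → code z = code z' → c z = c z' := by
  classical
  refine ⟨fun z => if h : c z ∈ H then H.equivFin ⟨c z, h⟩ else 0, fun z h => ?_,
    fun z z' h h' e => ?_⟩
  · simp [h]
  · simp only [h, h', dif_pos] at e
    simpa using H.equivFin.injective (Fin.ext e)

theorem card_sparse_le (T : Type) [Fintype T] [DecidableEq T] (L n N : ℕ) (hn : 0 < n) (s : ℝ)
    (hs : 0 ≤ s) :
    (((Fintype.piFinset fun _ : T => Finset.range L).filter fun h =>
      (Finset.univ.filter fun t => h t ≠ 0).card * n ≤ N).card : ℝ) ≤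
      Real.exp (s * N / n + L * Real.exp (-s) * Fintype.card T) := by
  set H := (Fintype.piFinset fun _ : T => Finset.range L).filter fun h =>
      (Finset.univ.filter fun t => h t ≠ 0).card * n ≤ N with hH
  have hn' : (0 : ℝ) < n := by exact_mod_cast hn
  set φ : ℕ → ℝ := fun i => if i ≠ 0 then Real.exp (-s) else 1 with hφ
  have hφ0 : ∀ i, 0 ≤ φ i := fun i => by simp only [hφ]; split_ifs <;> positivity
  have h1 : ∀ h ∈ H, 1 ≤ Real.exp (s * N / n) * ∏ t, φ (h t) := by
    intro h hh
    have hc := (Finset.mem_filter.1 hh).2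
    have hc' : ((Finset.univ.filter fun t => h t ≠ 0).card : ℝ) ≤ N / n := by
      rw [le_div_iff₀ hn']; exact_mod_cast hc
    have : ∏ t, φ (h t) = Real.exp (-s) ^ (Finset.univ.filter fun t => h t ≠ 0).card := by
      simp only [hφ, Finset.prod_ite, Finset.prod_const, one_pow, mul_one]
    rw [this, ← Real.exp_nat_mul, ← Real.exp_add]
    apply Real.one_le_exp
    have := mul_le_mul_of_nonneg_left hc' hs
    rw [mul_div_assoc]
    linarith
  have h2 : (H.card : ℝ) ≤ ∑ h ∈ H, Real.exp (s * N / n) * ∏ t, φ (h t) := by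
    simpa using Finset.sum_le_sum h1
  have h3 : ∑ h ∈ H, Real.exp (s * N / n) * ∏ t, φ (h t) ≤
      ∑ h ∈ Fintype.piFinset fun _ : T => Finset.range L,
        Real.exp (s * N / n) * ∏ t, φ (h t) :=
    Finset.sum_le_sum_of_subset_of_nonneg (Finset.filter_subset _ _) fun h _ _ =>
      mul_nonneg (Real.exp_pos _).le (Finset.prod_nonneg fun t _ => hφ0 _)
  have h4 : ∑ i ∈ Finset.range L, φ i ≤ Real.exp (L * Real.exp (-s)) := by
    have : ∑ i ∈ Finset.range L, φ i ≤ L * Real.exp (-s) + 1 := by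
      have : ∀ i ∈ Finset.range L, φ i ≤ Real.exp (-s) + if i = 0 then 1 else 0 := by
        intro i _
        simp only [hφ]
        have := Real.exp_pos (-s)
        by_cases hi : i = 0 <;> simp [hi]
        exact this.le
      refine (Finset.sum_le_sum this).trans ?_
      rw [Finset.sum_add_distrib]
      simp only [Finset.sum_const, Finset.card_range, nsmul_eq_mul, Finset.sum_ite_eq']
      gcongr
      split_ifs <;> norm_num
    exact this.trans (Real.add_one_le_exp _)
  refine h2.trans (h3.trans ?_)
  rw [← Finset.mul_sum, Finset.sum_prod_piFinset (Finset.range L) (fun _ i => φ i), Real.exp_add]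
  gcongr
  rw [Finset.prod_const, Finset.card_univ, mul_comm (_ * _), Real.exp_nat_mul]
  gcongr

end Count

section Level

open scoped Pointwise

variable {G : Type} [Group G] [DecidableEq G]

namespace Lev

variable {ℓ : Lev G}

theorem card_markers_le {x : G → ℝ} {a : G → ℕ × ℤ} (h : ℓ.Valid x a) (T : Finset G) :
    (T.filter fun p => (a p).1 ≠ 0).card * ℓ.U.card ≤ (ℓ.U * T).card := by
  rw [mul_comm, ← Finset.card_product]
  refine Finset.card_le_card_of_injOn (fun z => z.1 * z.2) ?_ ?_
  · intro z hz
    simp only [Finset.coe_product, Set.mem_prod, Finset.mem_coe, Finset.mem_filter] at hz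
    exact Finset.mul_mem_mul hz.1 hz.2.1
  · rintro ⟨u, p⟩ hz ⟨u', p'⟩ hz' e
    simp only [Finset.coe_product, Set.mem_prod, Finset.mem_coe, Finset.mem_filter] at hz hz'
    have e' : u * p = u' * p' := e
    have e2 : u'⁻¹ * u * p = p' := by rw [mul_assoc, e', inv_mul_cancel_left]
    have h1 := h.sep (u'⁻¹ * u) (Finset.mul_mem_mul (Finset.inv_mem_inv hz'.1) hz.1) p hz.2.2
      (by rw [e2]; exact hz'.2.2)
    have h2 : u = u' := by rwa [inv_mul_eq_one, eq_comm] at h1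
    subst h2
    simpa using e'

open Classical in
/-- The marker label together with the offset used on the tile. -/
noncomputable def markCode (ℓ : Lev G) (z : (G → ℝ) × (G → ℕ × ℤ)) (p : G) : ℕ :=
  (z.2 p).1 * ℓ.M + if h : (z.2 p).1 ≠ 0 ∧ ℓ.Valid z.1 z.2 then (h.2.disc p).choose else 0

theorem markCode_div {z : (G → ℝ) × (G → ℕ × ℤ)} (p : G) :
    ℓ.markCode z p / ℓ.M = (z.2 p).1 := by
  have hM : 0 < ℓ.M := Nat.succ_pos _
  rw [markCode, mul_comm, Nat.mul_add_div hM]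
  split_ifs with h
  · rw [Nat.div_eq_of_lt (h.2.disc p).choose_spec.1, add_zero]
  · simp

theorem markCode_eq_zero {z : (G → ℝ) × (G → ℕ × ℤ)} {p : G} :
    ℓ.markCode z p = 0 ↔ (z.2 p).1 = 0 := by
  constructor
  · intro h
    rw [← markCode_div (ℓ := ℓ), h, Nat.zero_div]
  · intro h
    simp [markCode, h]

theorem markCode_lt {z : (G → ℝ) × (G → ℕ × ℤ)} (h : ℓ.Valid z.1 z.2) (p : G) :
    ℓ.markCode z p < (ℓ.q + 1) * ℓ.M := by
  have hM : 0 < ℓ.M := Nat.succ_pos _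
  rw [← Nat.div_lt_iff_lt_mul hM, markCode_div]
  exact Nat.lt_succ_of_le (h.le p)

theorem markCode_determines (hℓ : ℓ.Good) {z z' : (G → ℝ) × (G → ℕ × ℤ)} (h : ℓ.Valid z.1 z.2)
    (h' : ℓ.Valid z'.1 z'.2) {F : Finset G} (hF : ∀ g ∈ F, |z.1 g - z'.1 g| < 2 * ℓ.θ * ℓ.γ)
    (hc : ∀ p ∈ ℓ.D * F, ℓ.markCode z p = ℓ.markCode z' p) : ∀ g ∈ F, z.2 g = z'.2 g := by
  intro g hg
  have hγ := hℓ.γ_pos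
  have hω : ∀ v ∈ ℓ.D, (z.2 (v * g)).1 = (z'.2 (v * g)).1 := fun v hv => by
    rw [← markCode_div (ℓ := ℓ), hc _ (Finset.mul_mem_mul hv hg), markCode_div]
  have hsel : csel ℓ.D (fun g => (z.2 g).1) g = csel ℓ.D (fun g => (z'.2 g).1) g := csel_congr hω
  obtain ⟨hp1, hp2⟩ := csel_mem (ω := fun g => (z.2 g).1) (h.cov g)
  obtain ⟨-, hp2'⟩ := csel_mem (ω := fun g => (z'.2 g).1) (h'.cov g)
  rw [← hsel] at hp2'
  have hm := hc _ (Finset.mul_mem_mul hp1 hg)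
  set p := csel ℓ.D (fun g => (z.2 g).1) g * g with hp
  rw [markCode, markCode, dif_pos ⟨hp2, h⟩, dif_pos ⟨hp2', h'⟩] at hm
  have hωM : (z.2 p).1 * ℓ.M = (z'.2 p).1 * ℓ.M := by rw [hp, hω _ hp1]
  have hmm : (h.disc p).choose = (h'.disc p).choose := by omega
  obtain ⟨h1, h2⟩ := (h.disc p).choose_spec.2 g rfl
  obtain ⟨h1', h2'⟩ := (h'.disc p).choose_spec.2 g (by rw [← hsel])
  rw [← hmm] at h1' h2'
  refine Prod.ext (by simpa using hω 1 hℓ.one_mem) ?_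
  have hlt := abs_lt.1 (hF g hg)
  have key : ∀ c c' : ℤ, (c - c' - 1) * ℓ.γ < 0 → c ≤ c' := by
    intro c c' hcc
    have : (c - c' - 1 : ℝ) < 0 := by
      by_contra! h0
      exact absurd (mul_nonneg h0 hγ.le) (not_le.2 hcc)
    have : (c : ℝ) < c' + 1 := by linarith
    exact Int.lt_add_one_iff.1 (by exact_mod_cast this)
  apply le_antisymm <;> apply key <;> nlinarith

theorem exists_level_code (hℓ : ℓ.Good) {s : ℝ} (hs : 0 ≤ s) (F : Finset G) (B : Set (G → ℝ))
    (hB : ∀ x ∈ B, ∀ y ∈ B, ∀ g ∈ F, |x g - y g| < 2 * ℓ.θ * ℓ.γ) :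
    ∃ (N : ℕ) (code : (G → ℝ) × (G → ℕ × ℤ) → ℕ),
      (N : ℝ) ≤ Real.exp (s * (ℓ.U * (ℓ.D * F)).card / ℓ.U.card +
        ((ℓ.q + 1) * ℓ.M : ℕ) * Real.exp (-s) * (ℓ.D * F).card) ∧
      (∀ z, ℓ.Valid z.1 z.2 → code z < N) ∧
      ∀ z z', ℓ.Valid z.1 z.2 → ℓ.Valid z'.1 z'.2 → z.1 ∈ B → z'.1 ∈ B → code z = code z' →
        ∀ g ∈ F, z.2 g = z'.2 g := by
  set T := ℓ.D * F with hT
  set H := (Fintype.piFinset fun _ : T => Finset.range ((ℓ.q + 1) * ℓ.M)).filter fun h =>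
      (Finset.univ.filter fun t => h t ≠ 0).card * ℓ.U.card ≤ (ℓ.U * T).card with hH
  have hmem : ∀ z, ℓ.Valid z.1 z.2 → (fun t : T => ℓ.markCode z t) ∈ H := by
    intro z hz
    rw [hH, Finset.mem_filter]
    refine ⟨Fintype.mem_piFinset.2 fun t => Finset.mem_range.2 (markCode_lt hz _), ?_⟩
    refine le_trans ?_ (card_markers_le hz T)
    gcongr
    refine Finset.card_le_card_of_injOn (fun t => (t : G)) ?_ Subtype.val_injective.injOn
    intro t ht
    simp only [Finset.coe_filter, Set.mem_ofPred_eq, Finset.mem_univ, true_and] at ht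
    simp only [Finset.coe_filter, Set.mem_ofPred_eq]
    exact ⟨t.2, fun h0 => ht (markCode_eq_zero.2 h0)⟩
  obtain ⟨code, hc1, hc2⟩ := exists_nat_code H (fun z (t : T) => ℓ.markCode z t)
  refine ⟨H.card, code, ?_, fun z hz => hc1 z (hmem z hz), ?_⟩
  · have := card_sparse_le T ((ℓ.q + 1) * ℓ.M) ℓ.U.card (ℓ.U * T).card
      (Finset.card_pos.2 hℓ.U_ne) s hs
    rwa [Fintype.card_coe] at this
  · intro z z' hz hz' hzB hzB' e
    have := hc2 z z' (hmem z hz) (hmem z' hz') e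
    exact markCode_determines hℓ hz hz' (hB _ hzB _ hzB') fun p hp => congrFun this ⟨p, hp⟩

/-- Priorities obtained from the markers of a level. -/
noncomputable def prio (ℓ : Lev G) (e : G → ℕ) (ω : G → ℕ) (g : G) : ℕ :=
  Nat.pair (e (csel ℓ.D ω g)) (ω (csel ℓ.D ω g * g))

theorem prio_proper {e : G → ℕ} (he : Function.Injective e) {x : G → ℝ} {a : G → ℕ × ℤ}
    (h : ℓ.Valid x a) {S : Finset G} (hS : ℓ.D * S * ℓ.D ⊆ ℓ.R) :
    ∀ v ∈ S, v ≠ 1 → ∀ g, ℓ.prio e (fun g => (a g).1) (v * g) ≠ ℓ.prio e (fun g => (a g).1) g := by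
  intro v hv hv1 g heq
  obtain ⟨h1, h2⟩ := csel_mem (ω := fun g => (a g).1) (h.cov g)
  obtain ⟨h3, h4⟩ := Nat.pair_eq_pair.1 heq
  have h5 := he h3
  rw [h5] at h4
  set u := csel ℓ.D (fun g => (a g).1) g
  have h6 : u * v * u⁻¹ ∈ ℓ.R :=
    hS (Finset.mul_mem_mul (Finset.mul_mem_mul h1 hv) (D_inv h1))
  have h7 := h.ids _ h6 (u * g) h2 (by
    have h8 : u * v * u⁻¹ * (u * g) = u * (v * g) := by group
    rw [h8]; exact h4)
  exact hv1 (by simpa using h7)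

theorem prio_lt (hℓ : ℓ.Good) (e : G → ℕ) :
    ∃ n, ∀ ω : G → ℕ, (∀ g, ω g ≤ ℓ.q) → ∀ g, ℓ.prio e ω g < n := by
  obtain ⟨n, hn⟩ := ((ℓ.D ×ˢ Finset.range (ℓ.q + 1)).image fun z => Nat.pair (e z.1) z.2).bddAbove
  refine ⟨n + 1, fun ω hω g => Nat.lt_succ_of_le (hn ?_)⟩
  rw [Finset.mem_coe, Finset.mem_image]
  exact ⟨(csel ℓ.D ω g, ω (csel ℓ.D ω g * g)), Finset.mem_product.2
    ⟨csel_mem_of_one hℓ.one_mem _ _, Finset.mem_range.2 (Nat.lt_succ_of_le (hω _))⟩, rfl⟩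

/-- The datum at the level `ℓ` derived from a datum at the finer level `ℓ'`. -/
noncomputable def coarsen (ℓ ℓ' : Lev G) (e : G → ℕ) (a : G → ℕ × ℤ) : G → ℕ × ℤ :=
  ℓ.decode (ℓ'.prio e fun g => (a g).1) (fun g => (a g).2 * ℓ'.γ)

theorem coarsen_valid {ℓ' : Lev G} (hℓ : ℓ.Good) (hℓ' : ℓ'.Good) {e : G → ℕ}
    (he : Function.Injective e) (hR : ℓ'.D * ℓ.R * ℓ'.D ⊆ ℓ'.R) (hγ : 2 * ℓ'.γ ≤ ℓ.θ * ℓ.γ)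
    {x : G → ℝ} {a : G → ℕ × ℤ} (h : ℓ'.Valid x a) : ℓ.Valid x (ℓ.coarsen ℓ' e a) :=
  decode_valid hℓ (prio_proper he h hR) fun g => by
    rw [abs_sub_comm]; exact (h.accuracy hℓ' g).trans hγ

theorem coarsen_local (ℓ' : Lev G) (hℓ : ℓ.Good) (hℓ' : ℓ'.Good) (e : G → ℕ) :
    ∃ W : Finset G, ∀ a a' : G → ℕ × ℤ, (∀ g, (a g).1 ≤ ℓ'.q) → (∀ g, (a' g).1 ≤ ℓ'.q) →
      ∀ g g', (∀ w ∈ W, a (w * g) = a' (w * g')) → ℓ.coarsen ℓ' e a g = ℓ.coarsen ℓ' e a' g' := by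
  obtain ⟨n, hn⟩ := prio_lt hℓ' e
  have h1R : 1 ∈ ℓ.R := hℓ.D_sub hℓ.one_mem
  refine ⟨ℓ'.D * ℓ.R ^ n * ℓ.D ∪ ℓ.D * ℓ.D, fun a a' ha ha' g g' h => ?_⟩
  have hκ : ∀ k k', (∀ v ∈ ℓ'.D, a (v * k) = a' (v * k')) →
      ℓ'.prio e (fun g => (a g).1) k = ℓ'.prio e (fun g => (a' g).1) k' := by
    intro k k' hk
    have h1 : csel ℓ'.D (fun g => (a g).1) k = csel ℓ'.D (fun g => (a' g).1) k' :=
      csel_congr fun v hv => by rw [hk v hv]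
    rw [prio, prio, h1, hk _ (csel_mem_of_one hℓ'.one_mem _ _)]
  have hω : ∀ v ∈ ℓ.D, greedy ℓ.D ℓ.R (ℓ'.prio e fun g => (a g).1) (v * g) =
      greedy ℓ.D ℓ.R (ℓ'.prio e fun g => (a' g).1) (v * g') := by
    intro v hv
    refine greedy_local hℓ.D_sub h1R n _ _ (hn _ ha _) fun w hw => hκ _ _ fun u hu => ?_
    rw [← mul_assoc, ← mul_assoc, ← mul_assoc, ← mul_assoc]
    exact h _ (Finset.mem_union_left _ (Finset.mul_mem_mul (Finset.mul_mem_mul hu hw) hv))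
  have hsel := csel_congr hω
  have hs := csel_mem_of_one hℓ.one_mem (greedy ℓ.D ℓ.R (ℓ'.prio e fun g => (a' g).1)) g'
  have hy : ∀ u ∈ ℓ.D, ∀ v ∈ ℓ.D, a (u * (v * g)) = a' (u * (v * g')) := fun u hu v hv => by
    rw [← mul_assoc, ← mul_assoc]
    exact h _ (Finset.mem_union_right _ (Finset.mul_mem_mul hu hv))
  have h11 : a g = a' g' := by simpa using hy 1 hℓ.one_mem 1 hℓ.one_mem
  have hoff : ∀ v ∈ ℓ.D, ℓ.offset (fun g => (a g).2 * ℓ'.γ) (v * g) =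
      ℓ.offset (fun g => (a' g).2 * ℓ'.γ) (v * g') := by
    intro v hv
    unfold offset
    congr 1
    ext m
    exact forall_congr' fun u => forall_congr' fun hu => by simp only [hy u hu v hv]
  rw [coarsen, coarsen, decode, decode]
  refine Prod.ext (by simpa using hω 1 hℓ.one_mem) ?_
  simp only [hsel, hoff _ hs, h11]

end Lev
end Level

section Tower

open scoped Pointwise

variable {G : Type} [Group G] [DecidableEq G]

theorem IsFolner.card_mul_le {F : ℕ → Finset G} (hF : IsFolner G F) (K : Finset G) :
    ∀ᶠ n in atTop, (K * F n).card ≤ 2 * (F n).card := by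
  have h := hF.2 (insert 1 K) (Finset.insert_nonempty _ _)
  have h0 : (0 : ℝ) < 1 / (K.card + 1) := by positivity
  filter_upwards [h.eventually (gt_mem_nhds h0)] with n hn
  have hF0 : (0 : ℝ) < (F n).card := by exact_mod_cast (hF.1 n).card_pos
  have hfin : (folnerB G (F n) (insert 1 K)).Finite := by
    refine ((insert 1 K)⁻¹ * F n).finite_toSet.subset ?_
    rintro g ⟨⟨k, hk, hkg⟩, -⟩
    have := Finset.mul_mem_mul (Finset.inv_mem_inv hk) hkg
    rwa [inv_mul_cancel_left] at this
  have hsub : K * F n ⊆ F n ∪ K * hfin.toFinset := by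
    intro x hx
    obtain ⟨k, hk, g, hg, rfl⟩ := Finset.mem_mul.1 hx
    by_cases hkg : k * g ∈ F n
    · exact Finset.mem_union_left _ hkg
    · refine Finset.mem_union_right _ (Finset.mul_mem_mul hk (hfin.mem_toFinset.2 ?_))
      exact ⟨⟨1, by simp, by simpa using hg⟩, k, by simp [hk], hkg⟩
  have h1 := (Finset.card_le_card hsub).trans (Finset.card_union_le _ _)
  have h2 : (K * hfin.toFinset).card ≤ K.card * hfin.toFinset.card := Finset.card_mul_le
  rw [Set.ncard_eq_toFinset_card _ hfin, div_lt_div_iff₀ hF0 (by positivity)] at hn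
  have h3 : hfin.toFinset.card * (K.card + 1) < 1 * (F n).card := by exact_mod_cast hn
  nlinarith

theorem exists_large_parameter (C : ℝ) {ε : ℝ} (hε : 0 < ε) :
    ∃ k : ℕ, 0 < k ∧ 2 * (k : ℝ) / (k ^ 2 : ℕ) + C * k ^ 12 * Real.exp (-k) ≤ ε := by
  have h1 : Tendsto (fun k : ℕ => 2 * (k : ℝ)⁻¹ + C * ((k : ℝ) ^ 12 * Real.exp (-k))) atTop
      (nhds (2 * 0 + C * 0)) :=
    ((tendsto_inv_atTop_nhds_zero_nat).const_mul 2).add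
      (((Real.tendsto_pow_mul_exp_neg_atTop_nhds_zero 12).comp
        tendsto_natCast_atTop_atTop).const_mul C)
  have h2 := h1.eventually (ge_mem_nhds (show 2 * 0 + C * 0 < ε by simpa using hε))
  obtain ⟨k, hk, hk0⟩ := (h2.and (eventually_gt_atTop 0)).exists
  refine ⟨k, hk0, le_trans (le_of_eq ?_) hk⟩
  have : (k : ℝ) ≠ 0 := by exact_mod_cast hk0.ne'
  push_cast
  field_simp

/-- The level `ℓ` has complexity at most `ε` per group element. -/
def Lev.Cheap (ℓ : Lev G) (ε : ℝ) : Prop :=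
  ∃ s : ℝ, 0 ≤ s ∧
    2 * s / ℓ.U.card + 2 * (((ℓ.q + 1) * ℓ.M : ℕ) : ℝ) * Real.exp (-s) ≤ ε

theorem exists_level [Infinite G] (S : Finset G) {ρ ε : ℝ} (hρ : 0 < ρ) (hε : 0 < ε) :
    ∃ ℓ : Lev G, ℓ.Good ∧ ℓ.D * S * ℓ.D ⊆ ℓ.R ∧ ℓ.γ = ρ ∧ ℓ.Cheap ε := by
  set S' : Finset G := insert 1 (S ∪ S⁻¹) with hS'
  obtain ⟨k, hk, hkε⟩ := exists_large_parameter (4 * (S'.card + 2)) hε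
  obtain ⟨U, hU⟩ := Infinite.exists_subset_card_eq G (k ^ 2)
  have hUne : U.Nonempty := Finset.card_pos.1 (by rw [hU]; positivity)
  set ℓ : Lev G := ⟨U, U⁻¹ * U * S' * (U⁻¹ * U), ρ⟩ with hℓ
  have hDR : ∀ T : Finset G, T ⊆ S' → ℓ.D * T * ℓ.D ⊆ ℓ.R := fun T hT =>
    Finset.mul_subset_mul_right (Finset.mul_subset_mul_left hT)
  have h1D : (1 : G) ∈ ℓ.D := by
    obtain ⟨u, hu⟩ := hUne
    have := Finset.mul_mem_mul (Finset.inv_mem_inv hu) hu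
    rwa [inv_mul_cancel] at this
  have h1S : (1 : G) ∈ S' := Finset.mem_insert_self _ _
  refine ⟨ℓ, ⟨hUne, ?_, ?_, hρ⟩, hDR S ?_, rfl, (k : ℝ), by positivity, ?_⟩
  · have hSS : S'⁻¹ = S' := by
      rw [hS']
      ext x
      simp only [Finset.mem_inv', Finset.mem_insert, Finset.mem_union, inv_eq_one, inv_inv]
      tauto
    have hR : ℓ.R⁻¹ = ℓ.R := by
      simp only [hℓ, mul_inv_rev, inv_inv, hSS, mul_assoc]
    intro r hr
    exact hR ▸ Finset.inv_mem_inv hr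
  · intro v hv
    have := Finset.mul_mem_mul (Finset.mul_mem_mul hv h1S) h1D
    rw [mul_one, mul_one] at this
    exact hDR S' subset_rfl this
  · intro x hx
    exact Finset.mem_insert_of_mem (Finset.mem_union_left _ hx)
  · refine le_trans ?_ hkε
    have hUc : ℓ.U.card = k ^ 2 := hU
    rw [hUc]
    have hDc : ℓ.D.card ≤ k ^ 4 := by
      refine Finset.card_mul_le.trans ?_
      rw [Finset.card_inv, hUc]
      exact le_of_eq (by ring)
    have hRc : ℓ.R.card ≤ k ^ 4 * S'.card * k ^ 4 := by
      refine Finset.card_mul_le.trans ?_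
      refine Nat.mul_le_mul (Finset.card_mul_le.trans (Nat.mul_le_mul_right _ hDc)) hDc
    have hk1 : 1 ≤ k := hk
    have h4 : 1 ≤ k ^ 4 := Nat.one_le_pow _ _ hk
    have h8 : 1 ≤ k ^ 8 := Nat.one_le_pow _ _ hk
    have hL : (ℓ.q + 1) * ℓ.M ≤ (S'.card + 2) * k ^ 8 * (2 * k ^ 4) := by
      refine Nat.mul_le_mul ?_ ?_
      · have : k ^ 4 * S'.card * k ^ 4 = S'.card * k ^ 8 := by ring
        unfold Lev.q
        nlinarith
      · unfold Lev.M
        omega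
    have hL' : (((ℓ.q + 1) * ℓ.M : ℕ) : ℝ) ≤ (S'.card + 2) * k ^ 8 * (2 * k ^ 4) := by
      exact_mod_cast hL
    have := mul_le_mul_of_nonneg_right hL' (Real.exp_pos (-(k : ℝ))).le
    push_cast at this ⊢
    nlinarith

/-- A sequence of levels, each deriving its markers from the next one. -/
structure IsTower (ℓ : ℕ → Lev G) : Prop where
  good : ∀ k, (ℓ k).Good
  range : ∀ k, (ℓ (k + 1)).D * (ℓ k).R * (ℓ (k + 1)).D ⊆ (ℓ (k + 1)).R
  mesh : ∀ k, 2 * (ℓ (k + 1)).γ ≤ (ℓ k).θ * (ℓ k).γ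
  mesh_le : ∀ k, 2 * (ℓ k).γ ≤ 1 / ((k : ℝ) + 1)
  cheap : ∀ k, (ℓ k).Cheap (1 / ((k : ℝ) + 1))

theorem exists_tower [Infinite G] : ∃ ℓ : ℕ → Lev G, IsTower ℓ := by
  have step : ∀ (k : ℕ) (ℓ : {ℓ : Lev G // ℓ.Good}), ∃ ℓ' : {ℓ : Lev G // ℓ.Good},
      ℓ'.1.D * ℓ.1.R * ℓ'.1.D ⊆ ℓ'.1.R ∧ 2 * ℓ'.1.γ ≤ ℓ.1.θ * ℓ.1.γ ∧
      2 * ℓ'.1.γ ≤ 1 / ((k : ℝ) + 1) ∧ ℓ'.1.Cheap (1 / ((k : ℝ) + 1)) := by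
    intro k ℓ
    have h1 : 0 < ℓ.1.θ * ℓ.1.γ := mul_pos Lev.θ_pos ℓ.2.γ_pos
    have h2 : (0 : ℝ) < 1 / ((k : ℝ) + 1) := by positivity
    obtain ⟨ℓ', hg, hR, hγ, hc⟩ := exists_level ℓ.1.R
      (show 0 < min (ℓ.1.θ * ℓ.1.γ) (1 / ((k : ℝ) + 1)) / 2 by positivity) h2
    have h3 := min_le_left (ℓ.1.θ * ℓ.1.γ) (1 / ((k : ℝ) + 1))
    have h4 := min_le_right (ℓ.1.θ * ℓ.1.γ) (1 / ((k : ℝ) + 1))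
    exact ⟨⟨ℓ', hg⟩, hR, by rw [hγ]; linarith, by rw [hγ]; linarith, hc⟩
  obtain ⟨ℓ₀, hℓ₀, -, -, -⟩ := exists_level (∅ : Finset G) one_pos one_pos
  choose next hn using step
  let L : ℕ → {ℓ : Lev G // ℓ.Good} := fun k => Nat.rec (next 0 ⟨ℓ₀, hℓ₀⟩) (fun k ℓ => next (k + 1) ℓ) k
  have hL : ∀ k, ∃ ℓ, L k = next k ℓ := by
    rintro (_ | k)
    · exact ⟨_, rfl⟩
    · exact ⟨_, rfl⟩
  refine ⟨fun k => (L k).1, fun k => (L k).2, fun k => (hn (k + 1) (L k)).1,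
    fun k => (hn (k + 1) (L k)).2.1, fun k => ?_, fun k => ?_⟩
  · obtain ⟨ℓ, h⟩ := hL k
    simp only [h]
    exact (hn k ℓ).2.2.1
  · obtain ⟨ℓ, h⟩ := hL k
    simp only [h]
    exact (hn k ℓ).2.2.2

/-- The finite set in which data of a level take values. -/
noncomputable def Lev.box (ℓ : Lev G) : Finset (ℕ × ℤ) :=
  Finset.range (ℓ.q + 1) ×ˢ Finset.Icc (-3) (⌈1 / ℓ.γ⌉ + 3)

theorem Lev.Valid.mem_box {ℓ : Lev G} (hℓ : ℓ.Good) {x : G → ℝ} {a : G → ℕ × ℤ}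
    (h : ℓ.Valid x a) (hx : ∀ g, x g ∈ Set.Icc (0 : ℝ) 1) (g : G) : a g ∈ ℓ.box := by
  have hγ := hℓ.γ_pos
  have h1 := abs_le.1 (h.accuracy hℓ g)
  obtain ⟨h2, h3⟩ := hx g
  refine Finset.mem_product.2 ⟨Finset.mem_range.2 (Nat.lt_succ_of_le (h.le g)), ?_⟩
  rw [Finset.mem_Icc]
  constructor
  · have : (-3 : ℝ) ≤ (a g).2 := by
      by_contra! h0
      nlinarith
    exact_mod_cast this
  · have h4 : 1 ≤ (⌈1 / ℓ.γ⌉ : ℝ) * ℓ.γ := by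
      rw [← div_le_iff₀ hγ]; exact Int.le_ceil _
    have : ((a g).2 : ℝ) ≤ ⌈1 / ℓ.γ⌉ + 3 := by
      by_contra! h0
      nlinarith
    exact_mod_cast this

theorem Lev.zero_mem_box {ℓ : Lev G} (hℓ : ℓ.Good) : (0, 0) ∈ ℓ.box := by
  have : 0 ≤ ⌈1 / ℓ.γ⌉ := Int.ceil_nonneg (by have := hℓ.γ_pos; positivity)
  refine Finset.mem_product.2 ⟨Finset.mem_range.2 (Nat.succ_pos _), ?_⟩
  rw [Finset.mem_Icc]
  constructor
  · norm_num
  · change (0 : ℤ) ≤ _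
    omega

/-- Functions together with consistent data at the levels up to `K`. -/
def stage (ℓ : ℕ → Lev G) (e : G → ℕ) (K : ℕ) : Set ((G → ℝ) × (ℕ → G → ℕ × ℤ)) :=
  {ξ | (∀ g, ξ.1 g ∈ Set.Icc (0 : ℝ) 1) ∧ (∀ k g, ξ.2 k g ∈ (ℓ k).box) ∧
    (∀ k ≤ K, (ℓ k).Valid ξ.1 (ξ.2 k)) ∧
    ∀ k < K, ξ.2 k = (ℓ k).coarsen (ℓ (k + 1)) e (ξ.2 (k + 1))}

/-- The closed set of functions with coherent data at all levels. -/
def extSet (ℓ : ℕ → Lev G) (e : G → ℕ) : Set ((G → ℝ) × (ℕ → G → ℕ × ℤ)) :=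
  ⋂ K, closure (stage ℓ e K)

variable {ℓ : ℕ → Lev G} {e : G → ℕ}

theorem stage_anti : Antitone (stage ℓ e) := fun _ _ h _ hξ =>
  ⟨hξ.1, hξ.2.1, fun k hk => hξ.2.2.1 k (hk.trans h), fun k hk => hξ.2.2.2 k (hk.trans_le h)⟩

theorem isClosed_extSet : IsClosed (extSet ℓ e) := isClosed_iInter fun _ => isClosed_closure

omit [Group G] [DecidableEq G] in
theorem isClosed_box_data :
    IsClosed {a : ℕ → G → ℕ × ℤ | ∀ k g, a k g ∈ (ℓ k).box} := by
  simp only [Set.ofPred_forall]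
  exact isClosed_iInter fun k => isClosed_iInter fun g =>
    ((ℓ k).box.finite_toSet.isClosed).preimage (by fun_prop)

omit [Group G] [DecidableEq G] in
theorem isCompact_box_data :
    IsCompact {a : ℕ → G → ℕ × ℤ | ∀ k g, a k g ∈ (ℓ k).box} := by
  have : {a : ℕ → G → ℕ × ℤ | ∀ k g, a k g ∈ (ℓ k).box} =
      Set.univ.pi fun k => Set.univ.pi fun _ => ((ℓ k).box : Set (ℕ × ℤ)) := by
    ext a; simp
  rw [this]
  exact isCompact_univ_pi fun k => isCompact_univ_pi fun _ => (ℓ k).box.finite_toSet.isCompact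

theorem extSet_box {ξ : (G → ℝ) × (ℕ → G → ℕ × ℤ)} (h : ξ ∈ extSet ℓ e) (k : ℕ) (g : G) :
    ξ.2 k g ∈ (ℓ k).box := by
  have h0 := Set.mem_iInter.1 h 0
  have hc : IsClosed {ξ : (G → ℝ) × (ℕ → G → ℕ × ℤ) | ∀ k g, ξ.2 k g ∈ (ℓ k).box} :=
    isClosed_box_data.preimage continuous_snd
  exact closure_minimal (fun ξ hξ => hξ.2.1) hc h0 k g

theorem extSet_accuracy (hℓ : IsTower ℓ) {ξ : (G → ℝ) × (ℕ → G → ℕ × ℤ)} (h : ξ ∈ extSet ℓ e)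
    (k : ℕ) (g : G) : |ξ.1 g - (ξ.2 k g).2 * (ℓ k).γ| ≤ 1 / ((k : ℝ) + 1) := by
  have h0 := Set.mem_iInter.1 h k
  have hc : IsClosed {ξ : (G → ℝ) × (ℕ → G → ℕ × ℤ) |
      |ξ.1 g - (ξ.2 k g).2 * (ℓ k).γ| ≤ 1 / ((k : ℝ) + 1)} := by
    have : Continuous fun ξ : (G → ℝ) × (ℕ → G → ℕ × ℤ) => ((ξ.2 k g).2 : ℝ) :=
      continuous_of_discreteTopology.comp (f := fun ξ : (G → ℝ) × (ℕ → G → ℕ × ℤ) => (ξ.2 k g).2)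
        (by fun_prop)
    exact isClosed_le (by fun_prop) continuous_const
  exact closure_minimal (fun ξ hξ =>
    ((hξ.2.2.1 k le_rfl).accuracy (hℓ.good k) g).trans (hℓ.mesh_le k)) hc h0

theorem extSet_determines (hℓ : IsTower ℓ) {x x' : G → ℝ} {a : ℕ → G → ℕ × ℤ}
    (h : (x, a) ∈ extSet ℓ e) (h' : (x', a) ∈ extSet ℓ e) : x = x' := by
  funext g
  have key : ∀ k : ℕ, |x g - x' g| ≤ 2 * (1 / ((k : ℝ) + 1)) := by
    intro k
    have h1 := abs_le.1 (extSet_accuracy hℓ h k g)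
    have h2 := abs_le.1 (extSet_accuracy hℓ h' k g)
    rw [abs_le]
    constructor <;> linarith [h1.1, h1.2, h2.1, h2.2]
  have hlim := (tendsto_one_div_add_atTop_nhds_zero_nat (𝕜 := ℝ)).const_mul 2
  have := ge_of_tendsto' hlim key
  rw [mul_zero] at this
  have := abs_nonpos_iff.1 this
  linarith

theorem coarsen_shift (hℓ : IsTower ℓ) (k : ℕ) {a : G → ℕ × ℤ} (ha : ∀ g, (a g).1 ≤ (ℓ (k + 1)).q)
    (h : G) : (ℓ k).coarsen (ℓ (k + 1)) e (fun g => a (g * h)) =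
      fun g => (ℓ k).coarsen (ℓ (k + 1)) e a (g * h) := by
  obtain ⟨W, hW⟩ := Lev.coarsen_local (ℓ (k + 1)) (hℓ.good k) (hℓ.good (k + 1)) e
  funext g
  exact hW _ _ (fun g => ha _) ha _ _ fun w _ => by rw [mul_assoc]

theorem extSet_shift (hℓ : IsTower ℓ) {ξ : (G → ℝ) × (ℕ → G → ℕ × ℤ)} (h : ξ ∈ extSet ℓ e)
    (k : G) : ((fun g => ξ.1 (g * k), fun i g => ξ.2 i (g * k)) : (G → ℝ) × (ℕ → G → ℕ × ℤ)) ∈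
      extSet ℓ e := by
  refine Set.mem_iInter.2 fun K => ?_
  have hc : Continuous fun ξ : (G → ℝ) × (ℕ → G → ℕ × ℤ) =>
    ((fun g => ξ.1 (g * k), fun i g => ξ.2 i (g * k)) : (G → ℝ) × (ℕ → G → ℕ × ℤ)) := by fun_prop
  refine map_mem_closure (f := fun ξ : (G → ℝ) × (ℕ → G → ℕ × ℤ) =>
    ((fun g => ξ.1 (g * k), fun i g => ξ.2 i (g * k)) : (G → ℝ) × (ℕ → G → ℕ × ℤ))) hc
    (Set.mem_iInter.1 h K) ?_
  rintro ξ ⟨h1, h2, h3, h4⟩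
  refine ⟨fun g => h1 _, fun i g => h2 _ _, fun i hi => (h3 i hi).shift k, fun i hi => ?_⟩
  have := coarsen_shift (e := e) hℓ i (fun g => (h3 (i + 1) hi).le g) k
  simp only [this, ← h4 i hi]

theorem exists_stage (hℓ : IsTower ℓ) (he : Function.Injective e) {x : G → ℝ}
    (hx : ∀ g, x g ∈ Set.Icc (0 : ℝ) 1) (K : ℕ) : ∀ b, (ℓ K).Valid x b →
      ∃ a, (x, a) ∈ stage ℓ e K ∧ a K = b := by
  induction K with
  | zero =>
    intro b hb
    refine ⟨Function.update (fun _ _ => (0, 0)) 0 b, ⟨hx, fun k g => ?_, fun k hk => ?_,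
      fun k hk => absurd hk (Nat.not_lt_zero _)⟩, by simp⟩
    · by_cases hk : k = 0
      · subst hk; simpa using hb.mem_box (hℓ.good 0) hx g
      · simpa [hk] using Lev.zero_mem_box (hℓ.good k)
    · obtain rfl : k = 0 := by omega
      simpa using hb
  | succ K ih =>
    intro b hb
    obtain ⟨a, ⟨-, h2, h3, h4⟩, hK⟩ := ih _
      (Lev.coarsen_valid (hℓ.good K) (hℓ.good (K + 1)) he (hℓ.range K) (hℓ.mesh K) hb)
    refine ⟨Function.update a (K + 1) b, ⟨hx, fun k g => ?_, fun k hk => ?_, fun k hk => ?_⟩,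
      by simp⟩
    · by_cases hk : k = K + 1
      · subst hk; simpa using hb.mem_box (hℓ.good _) hx g
      · simpa [hk] using h2 k g
    · by_cases hk' : k = K + 1
      · subst hk'; simpa using hb
      · simpa [hk'] using h3 k (by omega)
    · have h5 : k ≠ K + 1 := by omega
      by_cases hk' : k = K
      · subst hk'; simpa [h5] using hK
      · have h6 : k + 1 ≠ K + 1 := by omega
        simp only [ne_eq, h5, not_false_eq_true, Function.update_of_ne, h6]
        exact h4 k (by omega)

theorem extSet_surj (hℓ : IsTower ℓ) (he : Function.Injective e) {x : G → ℝ}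
    (hx : ∀ g, x g ∈ Set.Icc (0 : ℝ) 1) : ∃ a, (x, a) ∈ extSet ℓ e := by
  let C : ℕ → Set (ℕ → G → ℕ × ℤ) := fun K =>
    {a | ∀ k g, a k g ∈ (ℓ k).box} ∩ (fun a => (x, a)) ⁻¹' closure (stage ℓ e K)
  have hcl : ∀ K, IsClosed (C K) := fun K =>
    isClosed_box_data.inter (isClosed_closure.preimage (by fun_prop))
  obtain ⟨a, ha⟩ := IsCompact.nonempty_iInter_of_sequence_nonempty_isCompact_isClosed C
    (fun K a ha => ⟨ha.1, closure_mono (stage_anti (Nat.le_succ K)) ha.2⟩)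
    (fun K => by
      have hv : (ℓ K).Valid x ((ℓ K).decode e x) :=
        Lev.decode_valid (hℓ.good K) (fun v _ hv g h => hv (by simpa using he h)) fun g => by
          have := (hℓ.good K).γ_pos
          have := (ℓ K).θ_pos
          simp only [sub_self, abs_zero]
          positivity
      obtain ⟨a, ha, -⟩ := exists_stage hℓ he hx K _ hv
      exact ⟨a, ha.2.1, subset_closure ha⟩)
    (isCompact_box_data.of_isClosed_subset (hcl 0) Set.inter_subset_left) hcl
  exact ⟨a, Set.mem_iInter.2 fun K => (Set.mem_iInter.1 ha K).2⟩

theorem extSet_approx {ξ : (G → ℝ) × (ℕ → G → ℕ × ℤ)} (h : ξ ∈ extSet ℓ e) (K : ℕ)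
    (T : Finset G) {δ : ℝ} (hδ : 0 < δ) :
    ∃ ζ ∈ stage ℓ e K, ∀ g ∈ T, |ζ.1 g - ξ.1 g| < δ ∧ ∀ k ≤ K, ζ.2 k g = ξ.2 k g := by
  have ho : IsOpen (⋂ g ∈ T, {ζ : (G → ℝ) × (ℕ → G → ℕ × ℤ) | |ζ.1 g - ξ.1 g| < δ} ∩
      ⋂ k ∈ Finset.range (K + 1), {ζ | ζ.2 k g = ξ.2 k g}) := by
    refine isOpen_biInter_finset fun g _ => IsOpen.inter ?_ (isOpen_biInter_finset fun k _ => ?_)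
    · exact isOpen_lt (by fun_prop) continuous_const
    · exact (isOpen_discrete {ξ.2 k g}).preimage
        (f := fun ζ : (G → ℝ) × (ℕ → G → ℕ × ℤ) => ζ.2 k g) (by fun_prop)
  obtain ⟨ζ, hζ, hζ'⟩ := mem_closure_iff.1 (Set.mem_iInter.1 h K) _ ho (by simp [hδ])
  refine ⟨ζ, hζ', fun g hg => ?_⟩
  have := Set.mem_iInter₂.1 hζ g hg
  exact ⟨this.1, fun k hk => Set.mem_iInter₂.1 this.2 k (Finset.mem_range.2 (by omega))⟩

theorem stage_local (hℓ : IsTower ℓ) (K d : ℕ) : ∀ k, k + d = K → ∃ W : Finset G,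
    ∀ ζ ∈ stage ℓ e K, ∀ ζ' ∈ stage ℓ e K, ∀ g, (∀ w ∈ W, ζ.2 K (w * g) = ζ'.2 K (w * g)) →
      ζ.2 k g = ζ'.2 k g := by
  induction d with
  | zero =>
    rintro k rfl
    exact ⟨{1}, fun ζ _ ζ' _ g h => by simpa using h 1 (by simp)⟩
  | succ d ih =>
    intro k hk
    obtain ⟨W, hW⟩ := ih (k + 1) (by omega)
    obtain ⟨V, hV⟩ := Lev.coarsen_local (ℓ (k + 1)) (hℓ.good k) (hℓ.good (k + 1)) e
    refine ⟨W * V, fun ζ hζ ζ' hζ' g h => ?_⟩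
    rw [hζ.2.2.2 k (by omega), hζ'.2.2.2 k (by omega)]
    refine hV _ _ (hζ.2.2.1 _ (by omega)).le (hζ'.2.2.1 _ (by omega)).le _ _ fun v hv =>
      hW ζ hζ ζ' hζ' _ fun w hw => ?_
    rw [← mul_assoc]
    exact h _ (Finset.mul_mem_mul hw hv)

theorem extSet_complexity (hℓ : IsTower ℓ) {F : ℕ → Finset G} (hF : IsFolner G F)
    (k : ℕ) (w₀ : G) {ε : ℝ} (hε : 0 < ε) : ∃ W : Finset G, ∃ δ > 0, ∀ᶠ n in atTop,
      ∀ B : Set (G → ℝ),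
        (∀ x ∈ B, ∀ y ∈ B, ∀ w ∈ W, ∀ g ∈ F n, |x (w * g) - y (w * g)| < δ) →
        ∃ (N : ℕ) (code : (G → ℝ) × (ℕ → G → ℕ × ℤ) → ℕ), (N : ℝ) ≤ Real.exp (ε * (F n).card) ∧
          (∀ z ∈ extSet ℓ e, z.1 ∈ B → code z < N) ∧
          ∀ z ∈ extSet ℓ e, ∀ z' ∈ extSet ℓ e, z.1 ∈ B → z'.1 ∈ B → code z = code z' →
            ∀ g ∈ F n, z.2 k (w₀ * g) = z'.2 k (w₀ * g) := by
  obtain ⟨K₀, hK₀⟩ := exists_nat_one_div_lt hε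
  set K := k + K₀ with hK
  have hKε : 1 / ((K : ℝ) + 1) ≤ ε := by
    refine le_trans ?_ hK₀.le
    gcongr
    omega
  obtain ⟨V, hV⟩ := stage_local (e := e) hℓ K K₀ k hK.symm
  obtain ⟨s, hs, hcheap⟩ := hℓ.cheap K
  have hgood := hℓ.good K
  have hγ := hgood.γ_pos
  have hθ := (ℓ K).θ_pos
  have hδ : 0 < (ℓ K).θ * (ℓ K).γ := by positivity
  set W := V * {w₀} with hW
  refine ⟨W, (ℓ K).θ * (ℓ K).γ, hδ, ?_⟩
  filter_upwards [hF.card_mul_le ((ℓ K).D * W), hF.card_mul_le ((ℓ K).U * (ℓ K).D * W)]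
    with n hn1 hn2
  intro B hB
  set T := W * F n with hT
  have happ : ∀ z : (G → ℝ) × (ℕ → G → ℕ × ℤ), ∃ ζ, z ∈ extSet ℓ e → ζ ∈ stage ℓ e K ∧
      ∀ g ∈ T ∪ {w₀} * F n, |ζ.1 g - z.1 g| < (ℓ K).θ * (ℓ K).γ / 2 ∧
        ∀ k ≤ K, ζ.2 k g = z.2 k g := by
    intro z
    by_cases hz : z ∈ extSet ℓ e
    · obtain ⟨ζ, h1, h2⟩ := extSet_approx hz K (T ∪ {w₀} * F n) (half_pos hδ)
      exact ⟨ζ, fun _ => ⟨h1, h2⟩⟩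
    · exact ⟨z, fun h => absurd h hz⟩
  choose ζ hζ using happ
  have hB' : ∀ x ∈ {x | ∃ z ∈ extSet ℓ e, z.1 ∈ B ∧ (ζ z).1 = x},
      ∀ y ∈ {x | ∃ z ∈ extSet ℓ e, z.1 ∈ B ∧ (ζ z).1 = x}, ∀ g ∈ T,
        |x g - y g| < 2 * (ℓ K).θ * (ℓ K).γ := by
    rintro _ ⟨z, hz, hzB, rfl⟩ _ ⟨z', hz', hzB', rfl⟩ g hg
    have h1 := abs_lt.1 ((hζ z hz).2 g (Finset.mem_union_left _ hg)).1
    have h2 := abs_lt.1 ((hζ z' hz').2 g (Finset.mem_union_left _ hg)).1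
    obtain ⟨w, hw, f, hf, rfl⟩ := Finset.mem_mul.1 hg
    have h3 := abs_lt.1 (hB _ hzB _ hzB' w hw f hf)
    rw [abs_lt]
    constructor <;> linarith [h1.1, h1.2, h2.1, h2.2, h3.1, h3.2]
  obtain ⟨N, code, hN, hc1, hc2⟩ := Lev.exists_level_code hgood hs T _ hB'
  refine ⟨N, fun z => code ((ζ z).1, (ζ z).2 K), hN.trans ?_, fun z hz hzB => ?_, ?_⟩
  · apply Real.exp_le_exp.2
    have hU : (0 : ℝ) < (ℓ K).U.card := by exact_mod_cast hgood.U_ne.card_pos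
    have e1 : (((ℓ K).D * T).card : ℝ) ≤ 2 * (F n).card := by
      rw [hT, ← mul_assoc]; exact_mod_cast hn1
    have e2 : (((ℓ K).U * ((ℓ K).D * T)).card : ℝ) ≤ 2 * (F n).card := by
      rw [hT, ← mul_assoc, ← mul_assoc]; exact_mod_cast hn2
    calc s * ((ℓ K).U * ((ℓ K).D * T)).card / (ℓ K).U.card +
          (((ℓ K).q + 1) * (ℓ K).M : ℕ) * Real.exp (-s) * ((ℓ K).D * T).card
        ≤ s * (2 * (F n).card) / (ℓ K).U.card +
          (((ℓ K).q + 1) * (ℓ K).M : ℕ) * Real.exp (-s) * (2 * (F n).card) := by gcongr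
      _ = (2 * s / (ℓ K).U.card + 2 * (((ℓ K).q + 1) * (ℓ K).M : ℕ) * Real.exp (-s)) *
          (F n).card := by ring
      _ ≤ ε * (F n).card := by gcongr; exact hcheap.trans hKε
  · exact hc1 ((ζ z).1, (ζ z).2 K) ((hζ z hz).1.2.2.1 K le_rfl)
  · intro z hz z' hz' hzB hzB' hcode g hg
    have hkK : k ≤ K := Nat.le_add_right _ _
    have hmem : w₀ * g ∈ T ∪ {w₀} * F n :=
      Finset.mem_union_right _ (Finset.mul_mem_mul (Finset.mem_singleton_self _) hg)
    rw [← ((hζ z hz).2 _ hmem).2 k hkK, ← ((hζ z' hz').2 _ hmem).2 k hkK]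
    refine hV _ (hζ z hz).1 _ (hζ z' hz').1 _ fun w hw => ?_
    refine hc2 ((ζ z).1, (ζ z).2 K) ((ζ z').1, (ζ z').2 K) ((hζ z hz).1.2.2.1 K le_rfl)
      ((hζ z' hz').1.2.2.1 K le_rfl) ⟨z, hz, hzB, rfl⟩ ⟨z', hz', hzB', rfl⟩ hcode _ ?_
    rw [← mul_assoc]
    exact Finset.mul_mem_mul (Finset.mul_mem_mul hw (Finset.mem_singleton_self _)) hg

end Tower

/-- A closed shift-invariant extension of the space of `[0,1]`-valued functions by symbolic data
which determine the function and have vanishing relative complexity. -/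
structure IsSymbolicExt {G : Type} [Group G] (F : ℕ → Finset G)
    (E : Set ((G → ℝ) × (ℕ → G → ℕ × ℤ))) (box : ℕ → Finset (ℕ × ℤ)) : Prop where
  isClosed : IsClosed E
  mem_box : ∀ ξ ∈ E, ∀ k g, ξ.2 k g ∈ box k
  shift : ∀ ξ ∈ E, ∀ h : G, (fun g => ξ.1 (g * h), fun i g => ξ.2 i (g * h)) ∈ E
  surj : ∀ x : G → ℝ, (∀ g, x g ∈ Set.Icc (0 : ℝ) 1) → ∃ a, (x, a) ∈ E
  determines : ∀ x x' a, (x, a) ∈ E → (x', a) ∈ E → x = x'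
  complexity : ∀ (k : ℕ) (w₀ : G) (ε : ℝ), 0 < ε → ∃ W : Finset G, ∃ δ > 0, ∀ᶠ n in atTop,
      ∀ B : Set (G → ℝ),
        (∀ x ∈ B, ∀ y ∈ B, ∀ w ∈ W, ∀ g ∈ F n, |x (w * g) - y (w * g)| < δ) →
        ∃ (N : ℕ) (code : (G → ℝ) × (ℕ → G → ℕ × ℤ) → ℕ), (N : ℝ) ≤ Real.exp (ε * (F n).card) ∧
          (∀ z ∈ E, z.1 ∈ B → code z < N) ∧
          ∀ z ∈ E, ∀ z' ∈ E, z.1 ∈ B → z'.1 ∈ B → code z = code z' →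
            ∀ g ∈ F n, z.2 k (w₀ * g) = z'.2 k (w₀ * g)

theorem exists_symbolicExt {G : Type} [Group G] [Countable G] [Infinite G] {F : ℕ → Finset G}
    (hF : IsFolner G F) : ∃ E box, IsSymbolicExt F E box := by
  classical
  obtain ⟨ℓ, hℓ⟩ := exists_tower (G := G)
  obtain ⟨e, he⟩ := exists_injective_nat G
  exact ⟨extSet ℓ e, fun k => (ℓ k).box, isClosed_extSet, fun ξ hξ => extSet_box hξ,
    fun ξ hξ => extSet_shift hℓ hξ, fun x hx => extSet_surj hℓ he hx,
    fun x x' a => extSet_determines hℓ, fun k w₀ ε hε => extSet_complexity hℓ hF k w₀ hε⟩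

section Pressure

variable {G : Type} [Group G]

theorem dynDist_lt_iff (S : GSystem G) (F : Finset G) {x y : S.carrier} {ε : ℝ} (hε : 0 < ε) :
    dynDist S F x y < ε ↔ ∀ g ∈ F, dist (S.act g x) (S.act g y) < ε := by
  lift ε to ℝ≥0 using hε.le
  rw [dynDist, NNReal.coe_lt_coe, Finset.sup_lt_iff (by exact_mod_cast hε)]
  refine forall_congr' fun g => forall_congr' fun _ => ?_
  rw [dist_nndist, NNReal.coe_lt_coe]

theorem FactorMap.diamLT_image {S T : GSystem G} (ψ : FactorMap S T) (F : Finset G) {δ ε : ℝ}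
    (hδ : 0 < δ) (hε : 0 < ε) (h : ∀ x y, dist x y < δ → dist (ψ.toFun x) (ψ.toFun y) < ε)
    {U : Set S.carrier} (hU : diamLT S F U δ) : diamLT T F (ψ.toFun '' U) ε := by
  rintro _ ⟨x, hx, rfl⟩ _ ⟨y, hy, rfl⟩
  rw [dynDist_lt_iff _ _ hε]
  intro g hg
  rw [← ψ.equiv, ← ψ.equiv]
  exact h _ _ ((dynDist_lt_iff _ _ hδ).1 (hU x hx y hy) g hg)

/-- Points close in the metric stay close along a finite set of translations. -/
theorem exists_dynDist_lt (S : GSystem G) (F : Finset G) {ε : ℝ} (hε : 0 < ε) :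
    ∃ τ > 0, ∀ x y, dist x y < τ → dynDist S F x y < ε := by
  classical
  induction F using Finset.induction_on with
  | empty => exact ⟨1, one_pos, fun x y _ => by rw [dynDist_lt_iff _ _ hε]; simp⟩
  | insert g F hg ih =>
    obtain ⟨τ, hτ, h⟩ := ih
    obtain ⟨τ', hτ', h'⟩ := Metric.uniformContinuous_iff.1
      (CompactSpace.uniformContinuous_of_continuous (S.cont_act g)) ε hε
    refine ⟨min τ τ', lt_min hτ hτ', fun x y hxy => ?_⟩
    rw [dynDist_lt_iff _ _ hε]
    intro k hk
    rcases Finset.mem_insert.1 hk with rfl | hk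
    · exact h' (hxy.trans_le (min_le_right _ _))
    · exact (dynDist_lt_iff _ _ hε).1 (h x y (hxy.trans_le (min_le_left _ _))) k hk

theorem diamLT_thickening (S : GSystem G) (F : Finset G) {ε τ : ℝ} (hε : 0 < ε)
    (hτ : ∀ x y, dist x y < τ → dynDist S F x y < ε / 3) {U : Set S.carrier}
    (hU : diamLT S F U (ε / 3)) : diamLT S F (Metric.thickening τ U) ε := by
  intro x hx y hy
  obtain ⟨x', hx', hxx⟩ := Metric.mem_thickening_iff.1 hx
  obtain ⟨y', hy', hyy⟩ := Metric.mem_thickening_iff.1 hy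
  have hε3 : 0 < ε / 3 := by positivity
  rw [dynDist_lt_iff _ _ hε]
  intro g hg
  have h1 := (dynDist_lt_iff _ _ hε3).1 (hτ x x' hxx) g hg
  have h2 := (dynDist_lt_iff _ _ hε3).1 (hU x' hx' y' hy') g hg
  have h3 := (dynDist_lt_iff _ _ hε3).1 (hτ y y' hyy) g hg
  have h4 := dist_triangle4 (S.act g x) (S.act g x') (S.act g y') (S.act g y)
  rw [dist_comm (S.act g y')] at h4
  linarith

theorem exists_diamLT_cover (S : GSystem G) (F : Finset G) {ε : ℝ} (hε : 0 < ε) :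
    ∃ (n : ℕ) (U : Fin n → Set S.carrier), (∀ j, IsOpen (U j)) ∧ (Set.univ ⊆ ⋃ j, U j) ∧
      ∀ j, diamLT S F (U j) ε := by
  obtain ⟨τ, hτ, h⟩ := exists_dynDist_lt S F (show 0 < ε / 3 by positivity)
  obtain ⟨t, -, ht, hcov⟩ := finite_cover_balls_of_compact (isCompact_univ (X := S.carrier)) hτ
  obtain ⟨n, e, he⟩ := ht.fin_param
  refine ⟨n, fun j => Metric.ball (e j) τ, fun j => Metric.isOpen_ball, ?_, fun j => ?_⟩
  · intro x hx
    obtain ⟨y, hy, hxy⟩ := Set.mem_iUnion₂.1 (hcov hx)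
    rw [← he.2] at hy
    obtain ⟨j, rfl⟩ := hy
    exact Set.mem_iUnion.2 ⟨j, hxy⟩
  · have := diamLT_thickening S F hε h (U := {e j}) (by
      rintro x rfl y rfl
      rw [dynDist_lt_iff _ _ (by positivity)]
      simpa using fun _ _ => hε)
    rwa [Metric.thickening_singleton] at this

theorem continuous_birk (S : GSystem G) {f : S.carrier → ℝ} (hf : Continuous f) (F : Finset G) :
    Continuous (birk S f F) :=
  continuous_finsetSum _ fun g _ => hf.comp (S.cont_act g)

theorem bddAbove_birk (S : GSystem G) {f : S.carrier → ℝ} (hf : Continuous f) (F : Finset G)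
    (U : Set S.carrier) : BddAbove (birk S f F '' U) :=
  (isCompact_univ.bddAbove_image (continuous_birk S hf F).continuousOn).mono
    (Set.image_mono (Set.subset_univ U))

section Single

variable (X : ℕ → GSystem G) (π : ∀ i, FactorMap (X i) (X (i + 1))) (a : ℕ → ℝ)
  (f : (X 0).carrier → ℝ) (F : Finset G)

theorem wP_nonneg (ε : ℝ) (i : ℕ) (Ω : Set (X i).carrier) : 0 ≤ wP X π a f F ε i Ω := by
  induction i with
  | zero =>
    refine Real.sInf_nonneg ?_
    rintro _ ⟨n, U, -, -, -, rfl⟩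
    exact Finset.sum_nonneg fun j _ => (Real.exp_pos _).le
  | succ i ih =>
    refine Real.sInf_nonneg ?_
    rintro _ ⟨n, U, -, -, -, rfl⟩
    exact Finset.sum_nonneg fun j _ => Real.rpow_nonneg (ih _) _

theorem wP_zero_le {ε : ℝ} {Ω : Set (X 0).carrier} {n : ℕ} {U : Fin n → Set (X 0).carrier}
    (h1 : ∀ j, IsOpen (U j)) (h2 : Ω ⊆ ⋃ j, U j) (h3 : ∀ j, diamLT (X 0) F (U j) ε) :
    wP X π a f F ε 0 Ω ≤ ∑ j, Real.exp (sSup (birk (X 0) f F '' U j)) := by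
  refine csInf_le ⟨0, ?_⟩ ⟨n, U, h1, h2, h3, rfl⟩
  rintro _ ⟨n, U, -, -, -, rfl⟩
  exact Finset.sum_nonneg fun j _ => (Real.exp_pos _).le

theorem wP_succ_le {ε : ℝ} {i : ℕ} {Ω : Set (X (i + 1)).carrier} {n : ℕ}
    {U : Fin n → Set (X (i + 1)).carrier}
    (h1 : ∀ j, IsOpen (U j)) (h2 : Ω ⊆ ⋃ j, U j) (h3 : ∀ j, diamLT (X (i + 1)) F (U j) ε) :
    wP X π a f F ε (i + 1) Ω ≤ ∑ j, (wP X π a f F ε i ((π i).toFun ⁻¹' U j)) ^ (a i) := by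
  refine csInf_le ⟨0, ?_⟩ ⟨n, U, h1, h2, h3, rfl⟩
  rintro _ ⟨n, U, -, -, -, rfl⟩
  exact Finset.sum_nonneg fun j _ => Real.rpow_nonneg (wP_nonneg X π a f F ε i _) _

theorem exists_cover_zero_lt {ε : ℝ} (hε : 0 < ε) (Ω : Set (X 0).carrier) {c : ℝ}
    (hc : wP X π a f F ε 0 Ω < c) : ∃ (n : ℕ) (U : Fin n → Set (X 0).carrier),
      (∀ j, IsOpen (U j)) ∧ (Ω ⊆ ⋃ j, U j) ∧ (∀ j, diamLT (X 0) F (U j) ε) ∧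
      ∑ j, Real.exp (sSup (birk (X 0) f F '' U j)) < c := by
  obtain ⟨n, U, h1, h2, h3⟩ := exists_diamLT_cover (X 0) F hε
  obtain ⟨_, ⟨n, U, h1, h2, h3, rfl⟩, h4⟩ := exists_lt_of_csInf_lt
    (by exact ⟨_, n, U, h1, (Set.subset_univ Ω).trans h2, h3, rfl⟩) hc
  exact ⟨n, U, h1, h2, h3, h4⟩

theorem exists_cover_succ_lt {ε : ℝ} (hε : 0 < ε) {i : ℕ} (Ω : Set (X (i + 1)).carrier) {c : ℝ}
    (hc : wP X π a f F ε (i + 1) Ω < c) : ∃ (n : ℕ) (U : Fin n → Set (X (i + 1)).carrier),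
      (∀ j, IsOpen (U j)) ∧ (Ω ⊆ ⋃ j, U j) ∧ (∀ j, diamLT (X (i + 1)) F (U j) ε) ∧
      ∑ j, (wP X π a f F ε i ((π i).toFun ⁻¹' U j)) ^ (a i) < c := by
  obtain ⟨n, U, h1, h2, h3⟩ := exists_diamLT_cover (X (i + 1)) F hε
  obtain ⟨_, ⟨n, U, h1, h2, h3, rfl⟩, h4⟩ := exists_lt_of_csInf_lt
    (by exact ⟨_, n, U, h1, (Set.subset_univ Ω).trans h2, h3, rfl⟩) hc
  exact ⟨n, U, h1, h2, h3, h4⟩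

theorem wP_mono {ε : ℝ} (hε : 0 < ε) (i : ℕ) {Ω Ω' : Set (X i).carrier} (h : Ω ⊆ Ω') :
    wP X π a f F ε i Ω ≤ wP X π a f F ε i Ω' := by
  refine le_of_forall_gt_imp_ge_of_dense fun c hc => ?_
  cases i with
  | zero =>
    obtain ⟨n, U, h1, h2, h3, h4⟩ := exists_cover_zero_lt X π a f F hε _ hc
    exact (wP_zero_le X π a f F h1 (h.trans h2) h3).trans h4.le
  | succ i =>
    obtain ⟨n, U, h1, h2, h3, h4⟩ := exists_cover_succ_lt X π a f F hε _ hc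
    exact (wP_succ_le X π a f F h1 (h.trans h2) h3).trans h4.le

theorem exists_wP_lower (hf : Continuous f) {r : ℕ} (ha : ∀ i < r, 0 ≤ a i) {ε : ℝ}
    (hε : 0 < ε) (i : ℕ) (hi : i ≤ r) :
    ∃ c > 0, ∀ Ω : Set (X i).carrier, Ω.Nonempty → c ≤ wP X π a f F ε i Ω := by
  induction i with
  | zero =>
    obtain ⟨C, hC⟩ := (isCompact_univ.bddBelow_image (continuous_birk (X 0) hf F).continuousOn)
    refine ⟨Real.exp C, Real.exp_pos _, fun Ω hΩ => le_of_forall_gt_imp_ge_of_dense fun c hc => ?_⟩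
    obtain ⟨n, U, h1, h2, h3, h4⟩ := exists_cover_zero_lt X π a f F hε _ hc
    obtain ⟨x, hx⟩ := hΩ
    obtain ⟨j, hj⟩ := Set.mem_iUnion.1 (h2 hx)
    refine le_trans ?_ h4.le
    refine le_trans ?_ (Finset.single_le_sum (f := fun j =>
      Real.exp (sSup (birk (X 0) f F '' U j))) (fun j _ => (Real.exp_pos _).le)
      (Finset.mem_univ j))
    refine Real.exp_le_exp.2 ((hC ⟨x, trivial, rfl⟩).trans ?_)
    exact le_csSup (bddAbove_birk _ hf F _) ⟨x, hj, rfl⟩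
  | succ i ih =>
    obtain ⟨c₀, hc₀, h₀⟩ := ih (by omega)
    refine ⟨c₀ ^ a i, Real.rpow_pos_of_pos hc₀ _, fun Ω hΩ =>
      le_of_forall_gt_imp_ge_of_dense fun c hc => ?_⟩
    obtain ⟨n, U, h1, h2, h3, h4⟩ := exists_cover_succ_lt X π a f F hε _ hc
    obtain ⟨x, hx⟩ := hΩ
    obtain ⟨j, hj⟩ := Set.mem_iUnion.1 (h2 hx)
    refine le_trans ?_ h4.le
    refine le_trans ?_ (Finset.single_le_sum (f := fun j =>
      (wP X π a f F ε i ((π i).toFun ⁻¹' U j)) ^ (a i))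
      (fun j _ => Real.rpow_nonneg (wP_nonneg X π a f F ε i _) _) (Finset.mem_univ j))
    obtain ⟨y, rfl⟩ := (π i).surj x
    exact Real.rpow_le_rpow hc₀.le (h₀ _ ⟨y, hj⟩) (ha i (by omega))

end Single

/-- A tower of factor maps `ψ i : Z i → X i` between two chains of factor maps for which every
square is weakly cartesian. -/
structure IsTowerExt {X Z : ℕ → GSystem G} (π : ∀ i, FactorMap (X i) (X (i + 1)))
    (Pis : ∀ i, FactorMap (Z i) (Z (i + 1))) (ψ : ∀ i, FactorMap (Z i) (X i)) : Prop where
  comm : ∀ i z, (ψ (i + 1)).toFun ((Pis i).toFun z) = (π i).toFun ((ψ i).toFun z)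
  lift : ∀ i x z', (π i).toFun x = (ψ (i + 1)).toFun z' →
    ∃ z, (Pis i).toFun z = z' ∧ (ψ i).toFun z = x

variable {X Z : ℕ → GSystem G} {π : ∀ i, FactorMap (X i) (X (i + 1))}
    {Pis : ∀ i, FactorMap (Z i) (Z (i + 1))} {ψ : ∀ i, FactorMap (Z i) (X i)}

theorem exists_pos_rpow_add_le (t : ℝ) {a η : ℝ} (ha : 0 ≤ a) (hη : 0 < η) :
    ∃ ξ > 0, (t + ξ) ^ a ≤ t ^ a + η := by
  obtain ⟨δ, hδ, h⟩ := Metric.continuous_iff.1 (Real.continuous_rpow_const ha) t η hη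
  refine ⟨δ / 2, half_pos hδ, ?_⟩
  have h1 := h (t + δ / 2) (by rw [Real.dist_eq, add_sub_cancel_left, abs_of_pos] <;> linarith)
  rw [Real.dist_eq] at h1
  linarith [(abs_lt.1 h1).2]

theorem wP_factor_le (h : IsTowerExt π Pis ψ) {r : ℕ} {a : ℕ → ℝ} (ha : ∀ i < r, 0 ≤ a i)
    {f : (X 0).carrier → ℝ} (hf : Continuous f) (F : Finset G) {δ ε : ℝ} (hδ : 0 < δ)
    (hε : 0 < ε) (i : ℕ) (hi : i ≤ r)
    (huc : ∀ j ≤ i, ∀ x y, dist x y < δ → dist ((ψ j).toFun x) ((ψ j).toFun y) < ε / 3) :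
    ∀ K : Set (Z i).carrier, IsCompact K → ∀ η > 0, ∃ V : Set (X i).carrier, IsOpen V ∧
      (ψ i).toFun '' K ⊆ V ∧
      wP X π a f F ε i V ≤ wP Z Pis a (f ∘ (ψ 0).toFun) F δ i K + η := by
  have hε3 : 0 < ε / 3 := by positivity
  induction i with
  | zero =>
    intro K _ η hη
    obtain ⟨n, U, h1, h2, h3, h4⟩ := exists_cover_zero_lt Z Pis a (f ∘ (ψ 0).toFun) F hδ K
      (lt_add_of_pos_right _ (half_pos hη))
    set S := ∑ j, Real.exp (sSup (birk (Z 0) (f ∘ (ψ 0).toFun) F '' U j)) with hS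
    have hS0 : 0 ≤ S := Finset.sum_nonneg fun j _ => (Real.exp_pos _).le
    set κ := Real.log (1 + η / (2 * (S + 1))) with hκ
    have hκ0 : 0 < κ := Real.log_pos (by
      have : 0 < η / (2 * (S + 1)) := by positivity
      linarith)
    obtain ⟨τ, hτ, hτ'⟩ := exists_dynDist_lt (X 0) F hε3
    obtain ⟨τ₂, hτ₂, hτ₂'⟩ := Metric.uniformContinuous_iff.1
      (CompactSpace.uniformContinuous_of_continuous (continuous_birk (X 0) hf F)) κ hκ0
    set V : Fin n → Set (X 0).carrier := fun j =>
      Metric.thickening (min τ τ₂) ((ψ 0).toFun '' U j) with hV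
    have hτm : 0 < min τ τ₂ := lt_min hτ hτ₂
    refine ⟨⋃ j, V j, isOpen_iUnion fun j => Metric.isOpen_thickening, ?_, ?_⟩
    · rintro _ ⟨z, hz, rfl⟩
      obtain ⟨j, hj⟩ := Set.mem_iUnion.1 (h2 hz)
      exact Set.mem_iUnion.2 ⟨j, Metric.self_subset_thickening hτm _ ⟨z, hj, rfl⟩⟩
    · refine (wP_zero_le X π a f F (U := V) (fun j => Metric.isOpen_thickening) subset_rfl
        fun j => diamLT_thickening _ F hε (fun x y hxy => hτ' x y (hxy.trans_le (min_le_left _ _)))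
          ((ψ 0).diamLT_image F hδ hε3 (huc 0 le_rfl) (h3 j))).trans ?_
      have hj : ∀ j, Real.exp (sSup (birk (X 0) f F '' V j)) ≤
          Real.exp (sSup (birk (Z 0) (f ∘ (ψ 0).toFun) F '' U j)) * Real.exp κ := by
        intro j
        rw [← Real.exp_add]
        apply Real.exp_le_exp.2
        rcases (V j).eq_empty_or_nonempty with hVj | hVj
        · have hUj : U j = ∅ := by
            rw [← Set.image_eq_empty (f := (ψ 0).toFun)]
            exact Set.subset_empty_iff.1 (hVj ▸ Metric.self_subset_thickening hτm _)
          rw [hVj, hUj]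
          simpa using hκ0.le
        · refine csSup_le (hVj.image _) ?_
          rintro _ ⟨x, hx, rfl⟩
          obtain ⟨_, ⟨z, hz, rfl⟩, hxy⟩ := Metric.mem_thickening_iff.1 hx
          have e1 := hτ₂' (hxy.trans_le (min_le_right _ _))
          rw [Real.dist_eq] at e1
          have e2 : birk (X 0) f F ((ψ 0).toFun z) = birk (Z 0) (f ∘ (ψ 0).toFun) F z := by
            simp only [birk, Function.comp, (ψ 0).equiv]
          have e3 := le_csSup (bddAbove_birk (Z 0) (hf.comp (ψ 0).cont) F (U j)) ⟨z, hz, rfl⟩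
          have e4 := (abs_lt.1 e1).2
          linarith
      refine (Finset.sum_le_sum fun j _ => hj j).trans ?_
      rw [← Finset.sum_mul, ← hS, hκ, Real.exp_log (by positivity)]
      have : S * (η / (2 * (S + 1))) ≤ η / 2 := by
        rw [mul_div_assoc', div_le_div_iff₀ (by positivity) (by positivity)]
        nlinarith
      linarith
  | succ i ih =>
    intro K hK η hη
    obtain ⟨n, U, h1, h2, h3, h4⟩ := exists_cover_succ_lt Z Pis a (f ∘ (ψ 0).toFun) F hδ K
      (lt_add_of_pos_right _ (half_pos hη))
    obtain ⟨K', hK'c, hK'U, hK'⟩ := hK.finite_compact_cover (t := Finset.univ) U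
      (fun j _ => h1 j) (by simpa using h2)
    have hη' : 0 < η / (2 * (n + 1)) := by positivity
    choose ξ hξ hξ' using fun j => exists_pos_rpow_add_le
      (wP Z Pis a (f ∘ (ψ 0).toFun) F δ i ((Pis i).toFun ⁻¹' U j)) (ha i (by omega)) hη'
    choose V hVo hKV hV using fun j => ih (by omega) (fun j hj => huc j (by omega))
      ((Pis i).toFun ⁻¹' K' j) ((hK'c j).isClosed.preimage (Pis i).cont).isCompact (ξ j) (hξ j)
    obtain ⟨τ, hτ, hτ'⟩ := exists_dynDist_lt (X (i + 1)) F hε3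
    set W : Fin n → Set (X (i + 1)).carrier := fun j =>
      ((π i).toFun '' (V j)ᶜ)ᶜ ∩ Metric.thickening τ ((ψ (i + 1)).toFun '' U j) with hW
    have hWo : ∀ j, IsOpen (W j) := fun j =>
      (((hVo j).isClosed_compl.isCompact.image (π i).cont).isClosed.isOpen_compl).inter
        Metric.isOpen_thickening
    refine ⟨⋃ j, W j, isOpen_iUnion hWo, ?_, ?_⟩
    · rintro _ ⟨z', hz', rfl⟩
      rw [hK'] at hz'
      obtain ⟨j, -, hj⟩ := Set.mem_iUnion₂.1 hz'
      refine Set.mem_iUnion.2 ⟨j, ?_, Metric.self_subset_thickening hτ _ ⟨z', hK'U j hj, rfl⟩⟩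
      rintro ⟨x, hx, hxz⟩
      obtain ⟨z, hz, rfl⟩ := h.lift i x z' hxz
      exact hx (hKV j ⟨z, by rw [Set.mem_preimage, hz]; exact hj, rfl⟩)
    · refine (wP_succ_le X π a f F hWo subset_rfl fun j x hx y hy =>
        diamLT_thickening _ F hε hτ'
          ((ψ (i + 1)).diamLT_image F hδ hε3 (huc _ le_rfl) (h3 j)) x hx.2 y hy.2).trans ?_
      have hj : ∀ j, (wP X π a f F ε i ((π i).toFun ⁻¹' W j)) ^ (a i) ≤
          (wP Z Pis a (f ∘ (ψ 0).toFun) F δ i ((Pis i).toFun ⁻¹' U j)) ^ (a i) +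
            η / (2 * (n + 1)) := by
        intro j
        refine le_trans ?_ (hξ' j)
        refine Real.rpow_le_rpow (wP_nonneg _ _ _ _ _ _ _ _) ?_ (ha i (by omega))
        refine (wP_mono X π a f F hε i (Ω' := V j) ?_).trans ((hV j).trans ?_)
        · intro x hx
          by_contra hxV
          exact hx.1 ⟨x, hxV, rfl⟩
        · gcongr
          exact wP_mono Z Pis a _ F hδ i (Set.preimage_mono (hK'U j))
      refine (Finset.sum_le_sum fun j _ => hj j).trans ?_
      rw [Finset.sum_add_distrib]
      have : ∑ _j : Fin n, η / (2 * ((n : ℝ) + 1)) ≤ η / 2 := by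
        rw [Finset.sum_const, Finset.card_univ, Fintype.card_fin, nsmul_eq_mul, mul_div_assoc',
          div_le_div_iff₀ (by positivity) (by positivity)]
        nlinarith
      linarith

theorem exists_common_modulus (ψ : ∀ i, FactorMap (Z i) (X i)) {ε : ℝ} (hε : 0 < ε) (r : ℕ) :
    ∃ δ > 0, ∀ j ≤ r, ∀ x y, dist x y < δ → dist ((ψ j).toFun x) ((ψ j).toFun y) < ε := by
  induction r with
  | zero =>
    obtain ⟨δ, hδ, h⟩ := Metric.uniformContinuous_iff.1
      (CompactSpace.uniformContinuous_of_continuous (ψ 0).cont) ε hε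
    refine ⟨δ, hδ, fun j hj x y => ?_⟩
    obtain rfl : j = 0 := by omega
    exact fun hxy => h hxy
  | succ r ih =>
    obtain ⟨δ₀, hδ₀, h₀⟩ := ih
    obtain ⟨δ, hδ, h⟩ := Metric.uniformContinuous_iff.1
      (CompactSpace.uniformContinuous_of_continuous (ψ (r + 1)).cont) ε hε
    refine ⟨min δ₀ δ, lt_min hδ₀ hδ, fun j hj x y hxy => ?_⟩
    by_cases hj' : j = r + 1
    · subst hj'; exact h (hxy.trans_le (min_le_right _ _))
    · exact h₀ j (by omega) x y (hxy.trans_le (min_le_left _ _))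

theorem chainMap_surjective (X : ℕ → GSystem G) (π : ∀ i, FactorMap (X i) (X (i + 1))) (i : ℕ) :
    Function.Surjective (chainMap X π i) := by
  induction i with
  | zero => exact Function.surjective_id
  | succ i ih => exact (π i).surj.comp ih

theorem press_le_of_towerExt (h : IsTowerExt π Pis ψ) [Nonempty (X 0).carrier] {r : ℕ}
    {a : ℕ → ℝ} (ha : ∀ i < r - 1, 0 ≤ a i) {f : (X 0).carrier → ℝ} (hf : Continuous f)
    (Fn : ℕ → Finset G) :
    press X π r a f Fn ≤ press Z Pis r a (f ∘ (ψ 0).toFun) Fn := by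
  refine iSup₂_le fun ε hε => ?_
  obtain ⟨δ, hδ, huc⟩ := exists_common_modulus ψ (show 0 < ε / 3 by positivity) (r - 1)
  refine le_trans ?_ (le_iSup₂ (f := fun (ε : ℝ) (_ : 0 < ε) =>
    pressEps Z Pis r a (f ∘ (ψ 0).toFun) Fn ε) δ hδ)
  refine limsup_le_limsup (Eventually.of_forall fun n => ?_)
  rw [EReal.coe_le_coe_iff]
  refine div_le_div_of_nonneg_right (Real.log_le_log ?_ ?_) (Nat.cast_nonneg _)
  · obtain ⟨c, hc, hc'⟩ := exists_wP_lower X π a f (Fn n) hf ha hε (r - 1) le_rfl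
    refine hc.trans_le (hc' _ ?_)
    exact ⟨chainMap X π (r - 1) (Classical.arbitrary _), trivial⟩
  · refine le_of_forall_pos_le_add fun η hη => ?_
    obtain ⟨V, -, hV, hle⟩ := wP_factor_le h ha hf (Fn n) hδ hε (r - 1) le_rfl huc Set.univ
      isCompact_univ η hη
    rw [Set.image_univ, (ψ (r - 1)).surj.range_eq] at hV
    rwa [Set.eq_univ_of_univ_subset hV] at hle

end Pressure

section Entropy

open MeasureTheory

/-- A map with finite range and measurable fibres, encoding a finite measurable partition. -/
structure IsFinPartition {Y : Type} [MeasurableSpace Y] {ι : Type} (p : Y → ι) : Prop where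
  finite_range : (Set.range p).Finite
  measurableSet_fiber : ∀ i, MeasurableSet (p ⁻¹' {i})

variable {Y : Type} [MeasurableSpace Y] {ι κ : Type} {p : Y → ι} {q : Y → κ}

theorem IsFinPartition.measurableSet_preimage (hp : IsFinPartition p) (s : Set ι) :
    MeasurableSet (p ⁻¹' s) := by
  have : p ⁻¹' s = ⋃ i ∈ Set.range p ∩ s, p ⁻¹' {i} := by
    ext y
    simp
  rw [this]
  exact (hp.finite_range.inter_of_left s).measurableSet_biUnion
    fun i _ => hp.measurableSet_fiber i

theorem IsFinPartition.comp (hp : IsFinPartition p) (φ : ι → κ) :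
    IsFinPartition (fun y => φ (p y)) := by
  refine ⟨?_, fun j => hp.measurableSet_preimage (φ ⁻¹' {j})⟩
  exact (hp.finite_range.image φ).subset (by rintro _ ⟨y, rfl⟩; exact ⟨p y, ⟨y, rfl⟩, rfl⟩)

theorem IsFinPartition.prod (hp : IsFinPartition p) (hq : IsFinPartition q) :
    IsFinPartition (fun y => (p y, q y)) := by
  refine ⟨(hp.finite_range.prod hq.finite_range).subset ?_, fun i => ?_⟩
  · rintro _ ⟨y, rfl⟩
    exact ⟨⟨y, rfl⟩, ⟨y, rfl⟩⟩
  · have : (fun y => (p y, q y)) ⁻¹' {i} = p ⁻¹' {i.1} ∩ q ⁻¹' {i.2} := by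
      ext y
      simp [Prod.ext_iff]
    rw [this]
    exact (hp.measurableSet_fiber _).inter (hq.measurableSet_fiber _)

theorem IsFinPartition.pi {β : Type} (J : Finset β) {p : β → Y → ι}
    (hp : ∀ j, IsFinPartition (p j)) :
    IsFinPartition (fun y => fun j : J => p j y) := by
  refine ⟨(Set.Finite.pi fun j : J => (hp j).finite_range).subset ?_, fun c => ?_⟩
  · rintro _ ⟨y, rfl⟩ j -
    exact ⟨y, rfl⟩
  · have : (fun y => fun j : J => p j y) ⁻¹' {c} = ⋂ j : J, p j ⁻¹' {c j} := by
      ext y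
      simp [funext_iff]
    rw [this]
    exact MeasurableSet.iInter fun j => (hp j).measurableSet_fiber _

theorem IsFinPartition.comp_measurable {Y' : Type} [MeasurableSpace Y'] (hp : IsFinPartition p)
    {T : Y' → Y} (hT : Measurable T) : IsFinPartition (fun y => p (T y)) :=
  ⟨hp.finite_range.subset (Set.range_comp_subset_range T p),
    fun i => hT (hp.measurableSet_fiber i)⟩

theorem Hpart_comp_map {Y' : Type} [MeasurableSpace Y'] {μ : Measure Y'} (hp : IsFinPartition p)
    {T : Y' → Y} (hT : Measurable T) :
    Hpart (μ.map T) p = Hpart μ (fun y => p (T y)) := by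
  unfold Hpart
  refine tsum_congr fun i => ?_
  rw [Measure.map_apply hT (hp.measurableSet_fiber i)]
  rfl

variable {μ : Measure Y}

theorem Hpart_eq_sum (T : Finset ι) (hT : ∀ y, p y ∈ T) :
    Hpart μ p = ∑ i ∈ T, Real.negMulLog (μ.real (p ⁻¹' {i})) := by
  refine tsum_eq_sum fun i hi => ?_
  have : p ⁻¹' {i} = ∅ := by
    ext y
    simp only [Set.mem_preimage, Set.mem_singleton_iff, Set.mem_empty_iff_false, iff_false]
    rintro rfl
    exact hi (hT y)
  simp [this]

variable [IsProbabilityMeasure μ]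

theorem Hpart_nonneg : 0 ≤ Hpart μ p :=
  tsum_nonneg fun _ => Real.negMulLog_nonneg measureReal_nonneg measureReal_le_one

theorem sum_measureReal_comp [DecidableEq κ] (hp : IsFinPartition p) (T : Finset ι)
    (hT : ∀ y, p y ∈ T) (φ : ι → κ) (j : κ) :
    μ.real ((fun y => φ (p y)) ⁻¹' {j}) = ∑ i ∈ T with φ i = j, μ.real (p ⁻¹' {i}) := by
  rw [← measureReal_biUnion_finset]
  · congr 1
    ext y
    simp [hT]
  · intro i _ i' _ hii'
    exact Set.disjoint_left.2 fun y hy hy' => hii' (hy.symm.trans hy')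
  · exact fun i _ => hp.measurableSet_fiber i

theorem sum_measureReal_eq_one (hp : IsFinPartition p) (T : Finset ι) (hT : ∀ y, p y ∈ T) :
    ∑ i ∈ T, μ.real (p ⁻¹' {i}) = 1 := by
  classical
  have := sum_measureReal_comp (μ := μ) hp T hT (fun _ => ()) ()
  simpa using this.symm

/-- Expectation of a function of a coarser partition. -/
theorem sum_measureReal_comp_mul [DecidableEq κ] (hp : IsFinPartition p) (T : Finset ι)
    (hT : ∀ y, p y ∈ T) (φ : ι → κ) (c : κ → ℝ) (T' : Finset κ) (hT' : ∀ i ∈ T, φ i ∈ T') :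
    ∑ j ∈ T', μ.real ((fun y => φ (p y)) ⁻¹' {j}) * c j =
      ∑ i ∈ T, μ.real (p ⁻¹' {i}) * c (φ i) := by
  rw [← Finset.sum_fiberwise_of_maps_to hT']
  refine Finset.sum_congr rfl fun j _ => ?_
  rw [sum_measureReal_comp hp T hT φ j, Finset.sum_mul]
  exact Finset.sum_congr rfl fun i hi => by rw [(Finset.mem_filter.1 hi).2]

theorem gibbs_inequality (T : Finset ι) {m r : ι → ℝ} (hm : ∀ i ∈ T, 0 ≤ m i)
    (hr : ∀ i ∈ T, 0 ≤ r i) (hmr : ∀ i ∈ T, 0 < m i → 0 < r i)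
    (hsum : ∑ i ∈ T, r i ≤ ∑ i ∈ T, m i) :
    ∑ i ∈ T, Real.negMulLog (m i) ≤ ∑ i ∈ T, m i * -Real.log (r i) := by
  have h : ∀ i ∈ T, Real.negMulLog (m i) ≤ m i * -Real.log (r i) + (r i - m i) := by
    intro i hi
    rcases (hm i hi).eq_or_lt with h0 | h0
    · rw [← h0]
      simpa using hr i hi
    · have h1 := Real.log_le_sub_one_of_pos (div_pos (hmr i hi h0) h0)
      rw [Real.log_div (hmr i hi h0).ne' h0.ne'] at h1
      have h2 := mul_le_mul_of_nonneg_left h1 h0.le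
      rw [mul_sub, mul_sub, mul_div_cancel₀ _ h0.ne'] at h2
      rw [Real.negMulLog]
      linarith
  have := Finset.sum_le_sum h
  rw [Finset.sum_add_distrib, Finset.sum_sub_distrib] at this
  linarith

theorem Hpart_comp_le (hp : IsFinPartition p) (φ : ι → κ) :
    Hpart μ (fun y => φ (p y)) ≤ Hpart μ p := by
  classical
  set T := hp.finite_range.toFinset
  have hT : ∀ y, p y ∈ T := fun y => by simp [T]
  rw [Hpart_eq_sum T hT, Hpart_eq_sum (T.image φ) fun y => Finset.mem_image_of_mem _ (hT y)]
  have := sum_measureReal_comp_mul (μ := μ) hp T hT φ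
    (fun j => -Real.log (μ.real ((fun y => φ (p y)) ⁻¹' {j}))) (T.image φ)
    fun i hi => Finset.mem_image_of_mem _ hi
  simp only [Real.negMulLog, neg_mul, mul_neg, Finset.sum_neg_distrib, neg_inj, neg_le_neg_iff]
    at this ⊢
  rw [this]
  refine Finset.sum_le_sum fun i _ => ?_
  rcases (measureReal_nonneg (μ := μ) (s := p ⁻¹' {i})).eq_or_lt with h0 | h0
  · simp [← h0]
  · refine mul_le_mul_of_nonneg_left (Real.log_le_log h0 (measureReal_mono ?_)) h0.le
    intro y hy
    exact congrArg φ hy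

theorem Hpart_prod_le (hp : IsFinPartition p) (hq : IsFinPartition q) :
    Hpart μ (fun y => (p y, q y)) ≤ Hpart μ p + Hpart μ q := by
  classical
  set T₁ := hp.finite_range.toFinset
  set T₂ := hq.finite_range.toFinset
  have h₁ : ∀ y, p y ∈ T₁ := fun y => by simp [T₁]
  have h₂ : ∀ y, q y ∈ T₂ := fun y => by simp [T₂]
  have h₁₂ : ∀ y, (p y, q y) ∈ T₁ ×ˢ T₂ := fun y => Finset.mk_mem_product (h₁ y) (h₂ y)
  have hpq := hp.prod hq
  rw [Hpart_eq_sum _ h₁₂, Hpart_eq_sum T₁ h₁, Hpart_eq_sum T₂ h₂]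
  have e₁ := sum_measureReal_comp_mul (μ := μ) hpq _ h₁₂ Prod.fst
    (fun j => -Real.log (μ.real (p ⁻¹' {j}))) T₁ fun i hi => (Finset.mem_product.1 hi).1
  have e₂ := sum_measureReal_comp_mul (μ := μ) hpq _ h₁₂ Prod.snd
    (fun j => -Real.log (μ.real (q ⁻¹' {j}))) T₂ fun i hi => (Finset.mem_product.1 hi).2
  have hle₁ : ∀ i : ι × κ, μ.real ((fun y => (p y, q y)) ⁻¹' {i}) ≤ μ.real (p ⁻¹' {i.1}) :=
    fun i => measureReal_mono fun y hy => congrArg Prod.fst hy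
  have hle₂ : ∀ i : ι × κ, μ.real ((fun y => (p y, q y)) ⁻¹' {i}) ≤ μ.real (q ⁻¹' {i.2}) :=
    fun i => measureReal_mono fun y hy => congrArg Prod.snd hy
  refine (gibbs_inequality (T₁ ×ˢ T₂) (r := fun i => μ.real (p ⁻¹' {i.1}) * μ.real (q ⁻¹' {i.2}))
    (fun i _ => measureReal_nonneg) (fun i _ => by positivity)
    (fun i _ h => mul_pos (h.trans_le (hle₁ i)) (h.trans_le (hle₂ i))) ?_).trans ?_
  · rw [sum_measureReal_eq_one hpq _ h₁₂, Finset.sum_product]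
    simp only [← Finset.mul_sum]
    rw [sum_measureReal_eq_one hq _ h₂]
    simp only [mul_one]
    rw [sum_measureReal_eq_one hp _ h₁]
  · simp only [Real.negMulLog, neg_mul, mul_neg] at e₁ e₂ ⊢
    rw [e₁, e₂, ← Finset.sum_add_distrib]
    refine Finset.sum_le_sum fun i _ => ?_
    rcases (measureReal_nonneg (μ := μ) (s := (fun y => (p y, q y)) ⁻¹' {i})).eq_or_lt
      with h0 | h0
    · simp [← h0]
    · rw [Real.log_mul (h0.trans_le (hle₁ i)).ne' (h0.trans_le (hle₂ i)).ne']
      exact le_of_eq (by ring)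

theorem Hpart_le_add_log (hp : IsFinPartition p) (hq : IsFinPartition q) {C : ℝ}
    (h : ∀ y₀, ∃ (N : ℕ) (code : Y → ℕ), (N : ℝ) ≤ C ∧ (∀ y, q y = q y₀ → code y < N) ∧
      ∀ y y', q y = q y₀ → q y' = q y₀ → code y = code y' → p y = p y') :
    Hpart μ p ≤ Hpart μ q + Real.log C := by
  classical
  obtain ⟨y₀⟩ : Nonempty Y := by
    by_contra hY
    have := not_nonempty_iff.1 hY
    exact IsProbabilityMeasure.ne_zero μ (Measure.eq_zero_of_isEmpty μ)
  have hC : 0 < C := by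
    obtain ⟨N, code, h1, h2, -⟩ := h y₀
    exact lt_of_lt_of_le (by exact_mod_cast (Nat.zero_le _).trans_lt (h2 y₀ rfl)) h1
  have hqp := hq.prod hp
  set T := hqp.finite_range.toFinset
  set T' := hq.finite_range.toFinset
  have hT : ∀ y, (q y, p y) ∈ T := fun y => (Set.Finite.mem_toFinset _).2 ⟨y, rfl⟩
  have hT' : ∀ y, q y ∈ T' := fun y => by simp [T']
  have hTT' : ∀ i ∈ T, i.1 ∈ T' := by
    intro i hi
    obtain ⟨y, rfl⟩ := (Set.Finite.mem_toFinset _).1 hi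
    exact hT' y
  have hcard : ∀ j ∈ T', ((T.filter fun i => i.1 = j).card : ℝ) ≤ C := by
    intro j hj
    obtain ⟨y₁, rfl⟩ := (Set.Finite.mem_toFinset _).1 hj
    obtain ⟨N, code, h1, h2, h3⟩ := h y₁
    refine le_trans ?_ h1
    rw [Nat.cast_le, ← Finset.card_range N]
    have hex : ∀ i ∈ T.filter (fun i => i.1 = q y₁), ∃ y, (q y, p y) = i ∧ q y = q y₁ := by
      intro i hi
      obtain ⟨hi, hi'⟩ := Finset.mem_filter.1 hi
      obtain ⟨y, rfl⟩ := (Set.Finite.mem_toFinset _).1 hi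
      exact ⟨y, rfl, hi'⟩
    have : Nonempty Y := ⟨y₁⟩
    choose! s hs hs' using hex
    refine Finset.card_le_card_of_injOn (fun i => code (s i))
      (fun i hi => Finset.mem_coe.2 (Finset.mem_range.2 (h2 _ (hs' i hi)))) ?_
    intro i hi i' hi' hii'
    rw [← hs i hi, ← hs i' hi', h3 _ _ (hs' i hi) (hs' i' hi') hii', hs' i hi, hs' i' hi']
  refine (Hpart_comp_le hqp Prod.snd).trans ?_
  rw [Hpart_eq_sum T hT, Hpart_eq_sum T' hT']
  have e := sum_measureReal_comp_mul (μ := μ) hqp _ hT Prod.fst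
    (fun j => -Real.log (μ.real (q ⁻¹' {j}))) T' hTT'
  have hle : ∀ i : κ × ι, μ.real ((fun y => (q y, p y)) ⁻¹' {i}) ≤ μ.real (q ⁻¹' {i.1}) :=
    fun i => measureReal_mono fun y hy => congrArg Prod.fst hy
  refine (gibbs_inequality T (r := fun i => μ.real (q ⁻¹' {i.1}) / C)
    (fun i _ => measureReal_nonneg) (fun i _ => by positivity)
    (fun i _ h => div_pos (h.trans_le (hle i)) hC) ?_).trans ?_
  · rw [sum_measureReal_eq_one hqp _ hT, ← sum_measureReal_eq_one (μ := μ) hq _ hT',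
      ← Finset.sum_fiberwise_of_maps_to hTT']
    refine Finset.sum_le_sum fun j hj => ?_
    rw [Finset.sum_congr rfl fun i hi => by rw [(Finset.mem_filter.1 hi).2], Finset.sum_const,
      nsmul_eq_mul, mul_div_assoc', div_le_iff₀ hC, mul_comm]
    exact mul_le_mul_of_nonneg_left (hcard j hj) measureReal_nonneg
  · have e1 := sum_measureReal_eq_one (μ := μ) hqp _ hT
    simp only [Real.negMulLog, neg_mul, mul_neg] at e ⊢
    rw [e, ← one_mul (Real.log C), ← e1, Finset.sum_mul, ← Finset.sum_add_distrib]
    refine Finset.sum_le_sum fun i _ => ?_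
    rcases (measureReal_nonneg (μ := μ) (s := (fun y => (q y, p y)) ⁻¹' {i})).eq_or_lt
      with h0 | h0
    · simp [← h0]
    · rw [Real.log_div (h0.trans_le (hle i)).ne' hC.ne']
      exact le_of_eq (by ring)

theorem Hpart_le_of_determined (hp : IsFinPartition p) (hq : IsFinPartition q)
    (h : ∀ y y', q y = q y' → p y = p y') : Hpart μ p ≤ Hpart μ q := by
  have := Hpart_le_add_log (μ := μ) hp hq (C := 1) fun y₀ => ⟨1, fun _ => 0, by simp,
    fun _ _ => one_pos, fun y y' hy hy' _ => h y y' (hy.trans hy'.symm)⟩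
  simpa using this

theorem Hpart_pi_le {β : Type} [DecidableEq β] (J : Finset β) {p : β → Y → ι}
    (hp : ∀ j, IsFinPartition (p j)) :
    Hpart μ (fun y => fun j : J => p j y) ≤ ∑ j ∈ J, Hpart μ (p j) := by
  induction J using Finset.induction_on with
  | empty =>
    rw [Hpart_eq_sum {fun j => (Finset.notMem_empty j.1 j.2).elim}]
    · have h1 : ∀ c, (fun y : Y => fun j : (∅ : Finset β) => p j y) ⁻¹' {c} = Set.univ := by
        intro c
        ext y
        simp only [Set.mem_preimage, Set.mem_singleton_iff, Set.mem_univ, iff_true]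
        exact Subsingleton.elim _ _
      simp [h1]
    · exact fun y => Finset.mem_singleton.2 (Subsingleton.elim _ _)
  | insert b J hb ih =>
    rw [Finset.sum_insert hb]
    refine (Hpart_le_of_determined (IsFinPartition.pi _ hp) ((hp b).prod (IsFinPartition.pi J hp))
      ?_).trans ((Hpart_prod_le (hp b) (IsFinPartition.pi J hp)).trans
        (add_le_add le_rfl ih))
    intro y y' hyy'
    obtain ⟨h1, h2⟩ := Prod.ext_iff.1 hyy'
    funext ⟨j, hj⟩
    rcases Finset.mem_insert.1 hj with rfl | hj
    · exact h1
    · exact congrFun h2 ⟨j, hj⟩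

end Entropy

section FactorEntropy

open MeasureTheory

theorem IsFinPartition.of_measurable {Y : Type} [MeasurableSpace Y] {p : Y → ℕ}
    (hp : Measurable p) (hfin : (Set.range p).Finite) : IsFinPartition p :=
  ⟨hfin, fun i => hp (measurableSet_singleton i)⟩

theorem IsFinPartition.measurable {Y : Type} [MeasurableSpace Y] {p : Y → ℕ}
    (hp : IsFinPartition p) : Measurable p :=
  measurable_to_countable' hp.measurableSet_fiber

theorem IsFinPartition.of_continuous {Y ι : Type} [TopologicalSpace Y] [CompactSpace Y]
    [MeasurableSpace Y] [BorelSpace Y] [TopologicalSpace ι] [DiscreteTopology ι] {p : Y → ι}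
    (hp : Continuous p) : IsFinPartition p :=
  ⟨(isCompact_range hp).finite_of_discrete,
    fun i => ((isClosed_discrete {i}).preimage hp).measurableSet⟩

/-- A partition whose distribution is close to a point mass has small entropy. -/
theorem exists_Hpart_le_of_measure_lt (T : Finset ℕ) {ε : ℝ} (hε : 0 < ε) :
    ∃ δ > 0, ∀ {Y : Type} [MeasurableSpace Y] (μ : Measure Y) [IsProbabilityMeasure μ]
      (e : Y → ℕ), IsFinPartition e → (∀ y, e y ∈ T) → μ.real {y | e y ≠ 0} < δ →
      Hpart μ e ≤ ε := by
  have hT : 0 < ε / (T.card + 1) := by positivity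
  obtain ⟨δ₀, hδ₀, h₀⟩ := Metric.continuous_iff.1 Real.continuous_negMulLog 0 _ hT
  obtain ⟨δ₁, hδ₁, h₁⟩ := Metric.continuous_iff.1 Real.continuous_negMulLog 1 _ hT
  refine ⟨min δ₀ δ₁, lt_min hδ₀ hδ₁, fun {Y} _ μ _ e he heT hμ => ?_⟩
  rw [Hpart_eq_sum T heT]
  have h : ∀ i ∈ T, Real.negMulLog (μ.real (e ⁻¹' {i})) ≤ ε / (T.card + 1) := by
    intro i _
    rcases eq_or_ne i 0 with rfl | hi
    · have hm : μ.real (e ⁻¹' {0}) = 1 - μ.real {y | e y ≠ 0} := by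
        have hs : MeasurableSet {y | e y ≠ 0} := he.measurableSet_preimage {0}ᶜ
        rw [← probReal_compl_eq_one_sub hs]
        congr 1
        ext y
        simp
      have := h₁ (μ.real (e ⁻¹' {0})) (by
        rw [hm, Real.dist_eq, sub_sub_cancel_left, abs_neg, abs_of_nonneg measureReal_nonneg]
        exact hμ.trans_le (min_le_right _ _))
      rw [Real.negMulLog_one, Real.dist_eq, sub_zero] at this
      exact (le_abs_self _).trans this.le
    · have hm : μ.real (e ⁻¹' {i}) ≤ μ.real {y | e y ≠ 0} :=
        measureReal_mono fun y hy => by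
          rw [Set.mem_preimage, Set.mem_singleton_iff] at hy
          exact ne_of_eq_of_ne hy hi
      have := h₀ (μ.real (e ⁻¹' {i})) (by
        rw [Real.dist_eq, sub_zero, abs_of_nonneg measureReal_nonneg]
        exact (hm.trans_lt hμ).trans_le (min_le_left _ _))
      rw [Real.negMulLog_zero, Real.dist_eq, sub_zero] at this
      exact (le_abs_self _).trans this.le
  refine (Finset.sum_le_card_nsmul T _ _ h).trans ?_
  rw [nsmul_eq_mul, mul_div_assoc', div_le_iff₀ (by positivity)]
  nlinarith

/-- A finite measurable partition is, up to a partition of small entropy, determined by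
finitely many members of a separating family of continuous discrete-valued maps. -/
theorem exists_error_partition {Z κ ι : Type} [MetricSpace Z] [CompactSpace Z]
    [MeasurableSpace Z] [BorelSpace Z] (ν : Measure Z) [IsProbabilityMeasure ν]
    [TopologicalSpace ι] [DiscreteTopology ι] {P : κ → Z → ι} (hP : ∀ j, Continuous (P j))
    (hinj : ∀ z z', (∀ j, P j z = P j z') → z = z') {q : Z → ℕ} (hq : IsFinPartition q)
    {ε : ℝ} (hε : 0 < ε) :
    ∃ (J : Finset κ) (e : Z → ℕ), IsFinPartition e ∧ Hpart ν e ≤ ε ∧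
      ∀ z z', (∀ j ∈ J, P j z = P j z') → e z = e z' → q z = q z' := by
  classical
  set T := hq.finite_range.toFinset
  have hT : ∀ z, q z ∈ T := fun z => (Set.Finite.mem_toFinset _).2 ⟨z, rfl⟩
  obtain ⟨δ, hδ, hδ'⟩ := exists_Hpart_le_of_measure_lt (insert 0 (T.image (· + 1))) hε
  have hδT : 0 < δ / (T.card + 1) := by positivity
  choose K hKsub hKc hKμ using fun i => (hq.measurableSet_fiber i).exists_isCompact_sdiff_lt
    (measure_ne_top ν _) (ENNReal.ofReal_pos.2 hδT).ne'
  set s : Set (Z × Z) := ⋃ i ∈ (T ×ˢ T).filter (fun i => i.1 ≠ i.2), K i.1 ×ˢ K i.2 with hs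
  have hsc : IsCompact s := Finset.isCompact_biUnion _ fun i _ => (hKc i.1).prod (hKc i.2)
  obtain ⟨J, hJ⟩ := hsc.elim_finite_subfamily_closed (fun j => {z : Z × Z | P j z.1 = P j z.2})
    (fun j => isClosed_eq ((hP j).comp continuous_fst) ((hP j).comp continuous_snd)) (by
      rw [Set.eq_empty_iff_forall_notMem]
      rintro ⟨z, z'⟩ ⟨hz, hz'⟩
      have hzz : z = z' := hinj z z' fun j => Set.mem_iInter.1 hz' j
      subst hzz
      obtain ⟨i, hi, h1, h2⟩ := Set.mem_iUnion₂.1 hz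
      exact (Finset.mem_filter.1 hi).2 ((hKsub _ h1).symm.trans (hKsub _ h2)))
  have hsep : ∀ z ∈ ⋃ i ∈ T, K i, ∀ z' ∈ ⋃ i ∈ T, K i, (∀ j ∈ J, P j z = P j z') →
      q z = q z' := by
    intro z hz z' hz' hzz
    obtain ⟨i, hi, hiz⟩ := Set.mem_iUnion₂.1 hz
    obtain ⟨i', hi', hiz'⟩ := Set.mem_iUnion₂.1 hz'
    by_contra hne
    have hii : i ≠ i' := fun hii => hne ((hKsub _ hiz).trans (hii.trans (hKsub _ hiz').symm))
    have : (z, z') ∈ s ∩ ⋂ j ∈ J, {z : Z × Z | P j z.1 = P j z.2} := by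
      refine ⟨Set.mem_iUnion₂.2 ⟨(i, i'), ?_, hiz, hiz'⟩, Set.mem_iInter₂.2 hzz⟩
      exact Finset.mem_filter.2 ⟨Finset.mk_mem_product hi hi', hii⟩
    rw [hJ] at this
    exact this
  have hαP : IsFinPartition (fun z => fun j : J => P j z) :=
    IsFinPartition.pi J fun j => IsFinPartition.of_continuous (hP j)
  set f : (J → ι) → ℕ := fun c => if h : ∃ z ∈ ⋃ i ∈ T, K i, (fun j : J => P j z) = c
    then q h.choose else 0 with hf
  have hf' : ∀ z ∈ ⋃ i ∈ T, K i, f (fun j : J => P j z) = q z := by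
    intro z hz
    have h : ∃ z' ∈ ⋃ i ∈ T, K i, (fun j : J => P j z') = fun j : J => P j z := ⟨z, hz, rfl⟩
    rw [hf]
    simp only [dif_pos h]
    exact hsep _ h.choose_spec.1 _ hz fun j hj => congrFun h.choose_spec.2 ⟨j, hj⟩
  have he := (hq.prod hαP).comp fun c => if c.1 = f c.2 then 0 else c.1 + 1
  refine ⟨J, _, he, hδ' ν _ he ?_ ?_, ?_⟩
  · intro z
    simp only
    split_ifs
    · exact Finset.mem_insert_self _ _
    · exact Finset.mem_insert_of_mem (Finset.mem_image_of_mem _ (hT z))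
  · calc ν.real {z | (if q z = f (fun j : J => P j z) then 0 else q z + 1) ≠ 0}
        ≤ ν.real (⋃ i ∈ T, q ⁻¹' {i} \ K i) := by
          refine measureReal_mono (fun z hz => ?_) (measure_ne_top ν _)
          refine Set.mem_iUnion₂.2 ⟨q z, hT z, rfl, fun hz' => hz ?_⟩
          rw [if_pos (hf' z (Set.mem_iUnion₂.2 ⟨q z, hT z, hz'⟩)).symm]
      _ ≤ ∑ i ∈ T, ν.real (q ⁻¹' {i} \ K i) := measureReal_biUnion_finset_le _ _
      _ ≤ T.card • (δ / (T.card + 1)) := Finset.sum_le_card_nsmul T _ _ fun i _ =>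
          ENNReal.toReal_le_of_le_ofReal hδT.le (hKμ i).le
      _ < δ := by
          rw [nsmul_eq_mul, mul_div_assoc', div_lt_iff₀ (by positivity)]
          nlinarith
  · intro z z' hzz hee
    have hα : (fun j : J => P j z) = fun j : J => P j z' := funext fun j => hzz j j.2
    simp only [hα] at hee
    split_ifs at hee with h1 h2
    · exact h1.trans h2.symm
    · exact Nat.succ_injective hee

variable {G : Type} [Group G]

theorem GSystem.measurable_act (S : GSystem G) (g : G) : Measurable (S.act g) :=
  (S.cont_act g).measurable

theorem IsFinPartition.orbit {S : GSystem G} {ι : Type} {p : S.carrier → ι}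
    (hp : IsFinPartition p) (F : Finset G) :
    IsFinPartition (fun x => fun g : F => p (S.act g x)) :=
  IsFinPartition.pi (p := fun g x => p (S.act g x)) F
    fun g => hp.comp_measurable (S.measurable_act g)

theorem IsInvProb.Hpart_orbit_le {S : GSystem G} {μ : Measure S.carrier} (hμ : IsInvProb S μ)
    {ι : Type} {p : S.carrier → ι} (hp : IsFinPartition p) (F : Finset G) :
    Hpart μ (fun x => fun g : F => p (S.act g x)) ≤ F.card * Hpart μ p := by
  classical
  have := hμ.1
  refine (Hpart_pi_le (p := fun g x => p (S.act g x)) F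
    fun g => hp.comp_measurable (S.measurable_act g)).trans ?_
  rw [← nsmul_eq_mul, ← Finset.sum_const]
  refine Finset.sum_le_sum fun g _ => ?_
  rw [← Hpart_comp_map hp (S.measurable_act g), hμ.2 g]

theorem IsInvProb.hSeq_term_le {S : GSystem G} {μ : Measure S.carrier} (hμ : IsInvProb S μ)
    {p : S.carrier → ℕ} (hp : IsFinPartition p) (F : Finset G) :
    Hpart μ (fun x => fun g : F => p (S.act g x)) / (F.card : ℝ) ≤ Hpart μ p := by
  have := hμ.1
  exact div_le_of_le_mul₀ (Nat.cast_nonneg _) Hpart_nonneg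
    (by rw [mul_comm]; exact hμ.Hpart_orbit_le hp F)

theorem exists_partition_dist_lt (S : GSystem G) {δ : ℝ} (hδ : 0 < δ) :
    ∃ β : S.carrier → ℕ, IsFinPartition β ∧ ∀ x y, β x = β y → dist x y < δ := by
  obtain ⟨t, -, ht, hcov⟩ := finite_cover_balls_of_compact (isCompact_univ (X := S.carrier))
    (half_pos hδ)
  obtain ⟨t, rfl⟩ := ht.exists_finset_coe
  have hb : ∀ c : S.carrier, IsFinPartition (fun x => x ∈ Metric.ball c (δ / 2)) := by
    refine fun c => ⟨Set.toFinite _, fun P => ?_⟩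
    by_cases hP : P
    · rw [eq_true hP]
      convert Metric.isOpen_ball (x := c) (ε := δ / 2) |>.measurableSet using 1
      ext x
      simp
    · rw [eq_false hP]
      convert (Metric.isOpen_ball (x := c) (ε := δ / 2) |>.measurableSet).compl using 1
      ext x
      simp
  obtain ⟨φ, hφ⟩ := exists_injective_nat (t → Prop)
  refine ⟨_, (IsFinPartition.pi t hb).comp φ, fun x y hxy => ?_⟩
  obtain ⟨c, hc, hxc⟩ := Set.mem_iUnion₂.1 (hcov (Set.mem_univ x))
  have hyc : y ∈ Metric.ball c (δ / 2) := (congrFun (hφ hxy) ⟨c, hc⟩).mp hxc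
  have := dist_triangle_right x y c
  rw [Metric.mem_ball] at hxc hyc
  linarith

/-- A discrete-valued map on an extension `ψ : Z → X` is tame if it has subexponential
complexity over Bowen balls of `X`. -/
def IsTame (F : ℕ → Finset G) {Z X : GSystem G} (ψ : FactorMap Z X) {ι : Type}
    (p : Z.carrier → ι) : Prop :=
  ∀ ε > 0, ∃ δ > 0, ∀ᶠ n in atTop, ∀ B : Set X.carrier, diamLT X (F n) B δ →
    ∃ (N : ℕ) (code : Z.carrier → ℕ), (N : ℝ) ≤ Real.exp (ε * (F n).card) ∧
      (∀ z, ψ.toFun z ∈ B → code z < N) ∧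
      ∀ z z', ψ.toFun z ∈ B → ψ.toFun z' ∈ B → code z = code z' →
        ∀ g ∈ F n, p (Z.act g z) = p (Z.act g z')

theorem IsTame.pi {F : ℕ → Finset G} {Z X : GSystem G} {ψ : FactorMap Z X} {ι κ : Type}
    {P : κ → Z.carrier → ι} (hP : ∀ j, IsTame F ψ (P j)) (J : Finset κ) :
    IsTame F ψ (fun z => fun j : J => P j z) := by
  classical
  induction J using Finset.induction_on with
  | empty =>
    intro ε hε
    refine ⟨1, one_pos, Eventually.of_forall fun n B _ => ⟨1, fun _ => 0, ?_, fun _ _ => one_pos,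
      fun _ _ _ _ _ _ _ => Subsingleton.elim _ _⟩⟩
    rw [Nat.cast_one]
    exact Real.one_le_exp (by positivity)
  | insert b J hb ih =>
    intro ε hε
    obtain ⟨δ₁, hδ₁, h₁⟩ := ih (ε / 2) (half_pos hε)
    obtain ⟨δ₂, hδ₂, h₂⟩ := hP b (ε / 2) (half_pos hε)
    refine ⟨min δ₁ δ₂, lt_min hδ₁ hδ₂, ?_⟩
    filter_upwards [h₁, h₂] with n h₁ h₂ B hB
    obtain ⟨N₁, c₁, hN₁, hc₁, hd₁⟩ := h₁ B fun x hx y hy =>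
      (hB x hx y hy).trans_le (min_le_left _ _)
    obtain ⟨N₂, c₂, hN₂, hc₂, hd₂⟩ := h₂ B fun x hx y hy =>
      (hB x hx y hy).trans_le (min_le_right _ _)
    refine ⟨N₁ * N₂, fun z => c₂ z + N₂ * c₁ z, ?_, fun z hz => ?_,
      fun z z' hz hz' hzz g hg => ?_⟩
    · have : ε * (F n).card = ε / 2 * (F n).card + ε / 2 * (F n).card := by ring
      rw [this, Real.exp_add, Nat.cast_mul]
      gcongr
    · have h1 := hc₁ z hz
      have h2 := hc₂ z hz
      calc c₂ z + N₂ * c₁ z < N₂ + N₂ * c₁ z := by omega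
        _ = N₂ * (c₁ z + 1) := by ring
        _ ≤ N₂ * N₁ := Nat.mul_le_mul_left _ h1
        _ = N₁ * N₂ := mul_comm _ _
    · have h2 := hc₂ z hz
      have h2' := hc₂ z' hz'
      have e2 : c₂ z = c₂ z' := by
        have := congrArg (· % N₂) hzz
        simpa [Nat.mod_eq_of_lt h2, Nat.mod_eq_of_lt h2'] using this
      have e1 : c₁ z = c₁ z' := by
        simp only [e2, add_right_inj] at hzz
        exact Nat.eq_of_mul_eq_mul_left ((Nat.zero_le _).trans_lt h2) hzz
      funext ⟨j, hj⟩
      rcases Finset.mem_insert.1 hj with rfl | hj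
      · exact hd₂ z z' hz hz' e2 g hg
      · exact congrFun (hd₁ z z' hz hz' e1 g hg) ⟨j, hj⟩

theorem IsInvProb.map {Z X : GSystem G} (ψ : FactorMap Z X) {ν : Measure Z.carrier}
    (hν : IsInvProb Z ν) : IsInvProb X (ν.map ψ.toFun) := by
  have := hν.1
  refine ⟨Measure.isProbabilityMeasure_map ψ.cont.measurable.aemeasurable, fun g => ?_⟩
  rw [Measure.map_map (X.measurable_act g) ψ.cont.measurable]
  conv_rhs => rw [← hν.2 g, Measure.map_map ψ.cont.measurable (Z.measurable_act g)]
  congr 1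
  funext z
  exact (ψ.equiv g z).symm

theorem exists_hSeq_le {F : ℕ → Finset G} {Z X : GSystem G} (ψ : FactorMap Z X)
    {ι κ : Type} [TopologicalSpace ι] [DiscreteTopology ι] {P : κ → Z.carrier → ι}
    (hPc : ∀ j, Continuous (P j)) (hinj : ∀ z z', (∀ j, P j z = P j z') → z = z')
    (hPt : ∀ j, IsTame F ψ (P j)) {ν : Measure Z.carrier} (hν : IsInvProb Z ν)
    {q : Z.carrier → ℕ} (hq : IsFinPartition q) {ε : ℝ} (hε : 0 < ε) :
    ∃ β : X.carrier → ℕ, IsFinPartition β ∧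
      hSeq Z F ν q ≤ hSeq X F (ν.map ψ.toFun) β + ε := by
  have := hν.1
  have hε3 : 0 < ε / 3 := by positivity
  obtain ⟨J, e, he, hHe, hJ⟩ := exists_error_partition ν hPc hinj hq hε3
  obtain ⟨δ, hδ, htame⟩ := IsTame.pi hPt J (ε / 3) hε3
  obtain ⟨β, hβ, hβδ⟩ := exists_partition_dist_lt X hδ
  have hα : IsFinPartition (fun z => fun j : J => P j z) :=
    IsFinPartition.pi J fun j => IsFinPartition.of_continuous (hPc j)
  set μ := ν.map ψ.toFun with hμdef
  have hμ : IsInvProb X μ := hν.map ψ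
  have := hμ.1
  refine ⟨β, hβ, ?_⟩
  have hbdd : IsBoundedUnder (· ≤ ·) atTop (fun n =>
      Hpart μ (fun x => fun g : F n => β (X.act g x)) / ((F n).card : ℝ)) :=
    isBoundedUnder_of ⟨_, fun n => hμ.hSeq_term_le hβ (F n)⟩
  have hlt := eventually_lt_of_limsup_lt (show hSeq X F μ β < hSeq X F μ β + ε / 3 by linarith)
    hbdd
  refine limsup_le_of_le (isCoboundedUnder_le_of_le atTop (x := 0) fun n =>
    div_nonneg Hpart_nonneg (Nat.cast_nonneg _)) ?_
  filter_upwards [hlt, htame] with n hn ht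
  have h1 : Hpart ν (fun z => fun g : F n => q (Z.act g z)) ≤
      Hpart ν (fun z => fun g : F n => fun j : J => P j (Z.act g z)) + (F n).card * (ε / 3) := by
    refine (Hpart_le_of_determined (hq.orbit (F n)) ((hα.orbit (F n)).prod (he.orbit (F n)))
      ?_).trans ((Hpart_prod_le (hα.orbit (F n)) (he.orbit (F n))).trans
        (add_le_add le_rfl ((hν.Hpart_orbit_le he (F n)).trans
          (mul_le_mul_of_nonneg_left hHe (Nat.cast_nonneg _)))))
    intro z z' hzz
    obtain ⟨e1, e2⟩ := Prod.ext_iff.1 hzz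
    funext g
    exact hJ _ _ (fun j hj => congrFun (congrFun e1 g) ⟨j, hj⟩) (congrFun e2 g)
  have h2 : Hpart ν (fun z => fun g : F n => fun j : J => P j (Z.act g z)) ≤
      Hpart μ (fun x => fun g : F n => β (X.act g x)) + (F n).card * (ε / 3) := by
    rw [hμdef, Hpart_comp_map (hβ.orbit (F n)) ψ.cont.measurable, mul_comm,
      ← Real.log_exp (ε / 3 * (F n).card)]
    refine Hpart_le_add_log (hα.orbit (F n))
      ((hβ.orbit (F n)).comp_measurable ψ.cont.measurable) fun z₀ => ?_
    obtain ⟨N, code, hN, hc, hd⟩ := ht {x | (fun g : F n => β (X.act g x)) =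
        fun g : F n => β (X.act g (ψ.toFun z₀))} (by
      intro x hx y hy
      rw [dynDist_lt_iff _ _ hδ]
      intro g hg
      exact hβδ _ _ ((congrFun hx ⟨g, hg⟩).trans (congrFun hy ⟨g, hg⟩).symm))
    exact ⟨N, code, hN, fun z hz => hc z hz, fun z z' hz hz' hzz =>
      funext fun g => hd z z' hz hz' hzz g g.2⟩
  rcases (Nat.cast_nonneg (α := ℝ) (F n).card).eq_or_lt with h0 | h0
  · rw [← h0, div_zero] at hn ⊢
    linarith
  · rw [div_lt_iff₀ h0] at hn
    rw [div_le_iff₀ h0]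
    linarith

/-- An extension separated by tame continuous maps does not increase entropy. -/
theorem mEnt_le_of_isTame {F : ℕ → Finset G} {Z X : GSystem G} (ψ : FactorMap Z X)
    {ι κ : Type} [TopologicalSpace ι] [DiscreteTopology ι] {P : κ → Z.carrier → ι}
    (hPc : ∀ j, Continuous (P j)) (hinj : ∀ z z', (∀ j, P j z = P j z') → z = z')
    (hPt : ∀ j, IsTame F ψ (P j)) {ν : Measure Z.carrier} (hν : IsInvProb Z ν) :
    mEnt Z F ν ≤ mEnt X F (ν.map ψ.toFun) := by
  refine iSup_le fun ⟨q, hq, hqf⟩ => ?_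
  refine EReal.le_of_forall_lt_iff_le.1 fun c hc => ?_
  refine EReal.coe_le_coe_iff.2 (le_of_forall_pos_le_add fun η hη => ?_)
  obtain ⟨β, hβ, h⟩ := exists_hSeq_le ψ hPc hinj hPt hν (.of_measurable hq hqf) hη
  have h1 : ((hSeq X F (ν.map ψ.toFun) β : ℝ) : EReal) ≤ mEnt X F (ν.map ψ.toFun) :=
    le_iSup (fun p : {p : X.carrier → ℕ // Measurable p ∧ (Set.range p).Finite} =>
      ((hSeq X F (ν.map ψ.toFun) p.1 : ℝ) : EReal)) ⟨β, hβ.measurable, hβ.finite_range⟩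
  have h2 := EReal.coe_lt_coe_iff.1 (h1.trans_lt hc)
  linarith

end FactorEntropy

section Extension

variable {G : Type} [Group G] {F : ℕ → Finset G}
  {E : Set ((G → ℝ) × (ℕ → G → ℕ × ℤ))} {box : ℕ → Finset (ℕ × ℤ)} {κ : Type}

/-- Points of `S` together with symbolic names, in the symbolic extension `E` of the Hilbert
cube, of all the observables `u j`. -/
def nameSet (E : Set ((G → ℝ) × (ℕ → G → ℕ × ℤ))) (S : GSystem G) (u : κ → S.carrier → ℝ) :
    Set (S.carrier × (κ → ℕ → G → ℕ × ℤ)) :=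
  {ξ | ∀ j, (fun g => u j (S.act g ξ.1), ξ.2 j) ∈ E}

theorem IsSymbolicExt.isCompact_nameSet (hE : IsSymbolicExt F E box) (S : GSystem G)
    {u : κ → S.carrier → ℝ} (hu : ∀ j, Continuous (u j)) : IsCompact (nameSet E S u) := by
  have hc : IsCompact ((Set.univ : Set S.carrier) ×ˢ
      (Set.univ.pi fun _ => Set.univ.pi fun k => Set.univ.pi fun _ => (box k : Set (ℕ × ℤ)) :
        Set (κ → ℕ → G → ℕ × ℤ))) :=
    isCompact_univ.prod (isCompact_univ_pi fun _ => isCompact_univ_pi fun k =>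
      isCompact_univ_pi fun _ => (box k).finite_toSet.isCompact)
  refine hc.of_isClosed_subset ?_ fun ξ hξ =>
    ⟨trivial, fun j _ k _ g _ => hE.mem_box _ (hξ j) k g⟩
  rw [nameSet, Set.ofPred_forall]
  refine isClosed_iInter fun j => hE.isClosed.preimage ?_
  refine Continuous.prodMk (continuous_pi fun g => (hu j).comp ((S.cont_act g).comp ?_)) ?_
  · exact continuous_fst
  · exact (continuous_apply j).comp continuous_snd

/-- Translation on points and names. -/
def nameAct (S : GSystem G) (h : G) (ξ : S.carrier × (κ → ℕ → G → ℕ × ℤ)) :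
    S.carrier × (κ → ℕ → G → ℕ × ℤ) :=
  (S.act h ξ.1, fun j k g => ξ.2 j k (g * h))

theorem IsSymbolicExt.nameAct_mem (hE : IsSymbolicExt F E box) (S : GSystem G)
    {u : κ → S.carrier → ℝ} (h : G) {ξ : S.carrier × (κ → ℕ → G → ℕ × ℤ)}
    (hξ : ξ ∈ nameSet E S u) : nameAct S h ξ ∈ nameSet E S u := by
  intro j
  have := hE.shift _ (hξ j) h
  simp only [S.mul_act] at this
  exact this

theorem continuous_nameAct (S : GSystem G) (h : G) :
    Continuous (nameAct S h : S.carrier × (κ → ℕ → G → ℕ × ℤ) → _) := by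
  refine ((S.cont_act h).comp continuous_fst).prodMk ?_
  exact continuous_pi fun j => continuous_pi fun k => continuous_pi fun g =>
    (continuous_apply (g * h)).comp ((continuous_apply k).comp
      ((continuous_apply j).comp continuous_snd))

variable [Countable G] [Countable κ]

/-- The extension of `S` by symbolic names of the observables `u`. -/
noncomputable def nameExt (hE : IsSymbolicExt F E box) (S : GSystem G)
    (u : κ → S.carrier → ℝ) (hu : ∀ j, Continuous (u j)) : GSystem G where
  carrier := nameSet E S u
  metric := TopologicalSpace.metrizableSpaceMetric (nameSet E S u)
  cpt := isCompact_iff_compactSpace.1 (hE.isCompact_nameSet S hu)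
  act h ξ := ⟨nameAct S h ξ.1, hE.nameAct_mem S h ξ.2⟩
  one_act ξ := by
    refine Subtype.ext (Prod.ext (S.one_act _) ?_)
    simp [nameAct]
  mul_act g h ξ := by
    refine Subtype.ext (Prod.ext (S.mul_act _ _ _) ?_)
    simp [nameAct, mul_assoc]
  cont_act h := ((continuous_nameAct S h).comp continuous_subtype_val).subtype_mk _

variable (hE : IsSymbolicExt F E box) (S : GSystem G) (u : κ → S.carrier → ℝ)
  (hu : ∀ j, Continuous (u j))

theorem continuous_nameExt_val : Continuous
    (fun z : (nameExt hE S u hu).carrier => (z.1 : S.carrier × (κ → ℕ → G → ℕ × ℤ))) :=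
  continuous_subtype_val

theorem continuous_nameExt_of_val {Y : Type} [TopologicalSpace Y]
    {f : Y → (nameExt hE S u hu).carrier} (hf : Continuous fun y => (f y).1) : Continuous f :=
  continuous_induced_rng.2 hf

theorem nameExt_ext (hsep : ∀ x y, (∀ j, u j x = u j y) → x = y)
    {z z' : (nameExt hE S u hu).carrier} (h : z.1.2 = z'.1.2) : z = z' := by
  refine Subtype.ext (Prod.ext (hsep _ _ fun j => ?_) h)
  have h1 := hE.determines _ _ _ (z.2 j) (by rw [h]; exact z'.2 j)
  simpa only [S.one_act] using congrFun h1 1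

theorem totallyDisconnectedSpace_nameExt (hsep : ∀ x y, (∀ j, u j x = u j y) → x = y) :
    TotallyDisconnectedSpace (nameExt hE S u hu).carrier := by
  refine ⟨fun t _ ht x hx y hy => nameExt_ext hE S u hu hsep ?_⟩
  have hc : Continuous (fun z : (nameExt hE S u hu).carrier => z.1.2) :=
    continuous_snd.comp (continuous_nameExt_val hE S u hu)
  exact (ht.image _ hc.continuousOn).subsingleton ⟨x, hx, rfl⟩ ⟨y, hy, rfl⟩

omit [Countable G] in
theorem IsSymbolicExt.exists_name (hE : IsSymbolicExt F E box) (S : GSystem G) {v : S.carrier → ℝ}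
    (hv : ∀ x, v x ∈ Set.Icc (0 : ℝ) 1) (x : S.carrier) :
    ∃ s, (fun g => v (S.act g x), s) ∈ E :=
  hE.surj _ fun _ => hv _

/-- Forgetting the names. -/
noncomputable def nameExtFst (hu01 : ∀ j x, u j x ∈ Set.Icc (0 : ℝ) 1) :
    FactorMap (nameExt hE S u hu) S where
  toFun z := z.1.1
  cont := continuous_fst.comp (continuous_nameExt_val hE S u hu)
  surj x := by
    choose s hs using fun j => hE.exists_name S (hu01 j) x
    exact ⟨⟨(x, s), hs⟩, rfl⟩
  equiv _ _ := rfl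

theorem continuous_nameExt_coord (c : κ × ℕ × G) :
    Continuous (fun z : (nameExt hE S u hu).carrier => z.1.2 c.1 c.2.1 c.2.2) :=
  (continuous_apply c.2.2).comp ((continuous_apply c.2.1).comp ((continuous_apply c.1).comp
    (continuous_snd.comp (continuous_nameExt_val hE S u hu))))

theorem isTame_nameExt_coord (hu01 : ∀ j x, u j x ∈ Set.Icc (0 : ℝ) 1) (c : κ × ℕ × G) :
    IsTame F (nameExtFst hE S u hu hu01)
      (fun z : (nameExt hE S u hu).carrier => z.1.2 c.1 c.2.1 c.2.2) := by
  obtain ⟨j, k, w₀⟩ := c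
  intro ε hε
  obtain ⟨W, δ, hδ, hW⟩ := hE.complexity k w₀ ε hε
  obtain ⟨τ, hτ, hτδ⟩ := Metric.uniformContinuous_iff.1
    (CompactSpace.uniformContinuous_of_continuous
      (continuous_pi fun w : W => (hu j).comp (S.cont_act w))) δ hδ
  refine ⟨τ, hτ, hW.mono fun n hn B hB => ?_⟩
  obtain ⟨N, code, hN, hc, hd⟩ := hn ((fun x g => u j (S.act g x)) '' B) (by
    rintro _ ⟨x, hx, rfl⟩ _ ⟨y, hy, rfl⟩ w hw g hg
    have h1 := hτδ ((dynDist_lt_iff _ _ hτ).1 (hB x hx y hy) g hg)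
    have h2 := (dist_le_pi_dist _ _ (⟨w, hw⟩ : W)).trans_lt h1
    rw [Real.dist_eq] at h2
    simp only [Function.comp, ← S.mul_act] at h2
    exact h2)
  refine ⟨N, fun z => code (fun g => u j (S.act g z.1.1), z.1.2 j), hN,
    fun z hz => hc _ (z.2 j) ⟨_, hz, rfl⟩, fun z z' hz hz' hzz g hg => ?_⟩
  exact hd _ (z.2 j) _ (z'.2 j) ⟨_, hz, rfl⟩ ⟨_, hz', rfl⟩ hzz g hg

theorem mEnt_nameExt_le (hu01 : ∀ j x, u j x ∈ Set.Icc (0 : ℝ) 1)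
    (hsep : ∀ x y, (∀ j, u j x = u j y) → x = y)
    {ν : MeasureTheory.Measure (nameExt hE S u hu).carrier}
    (hν : IsInvProb (nameExt hE S u hu) ν) :
    mEnt (nameExt hE S u hu) F ν ≤ mEnt S F (ν.map (nameExtFst hE S u hu hu01).toFun) := by
  refine mEnt_le_of_isTame _ (continuous_nameExt_coord hE S u hu) (fun z z' h => ?_)
    (isTame_nameExt_coord hE S u hu hu01) hν
  exact nameExt_ext hE S u hu hsep (funext fun j => funext fun k => funext fun g => h (j, k, g))

omit [Countable G] in
theorem exists_separating_observables (S : GSystem G) :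
    ∃ U : ℕ → S.carrier → ℝ, (∀ d, Continuous (U d)) ∧ (∀ d x, U d x ∈ Set.Icc (0 : ℝ) 1) ∧
      ∀ x y, (∀ d, U d x = U d y) → x = y := by
  rcases isEmpty_or_nonempty S.carrier with hS | hS
  · exact ⟨fun _ _ => 0, fun _ => continuous_const, fun _ _ => by simp, fun x => hS.elim x⟩
  · refine ⟨fun d x => min (dist x (TopologicalSpace.denseSeq S.carrier d)) 1,
      fun d => (continuous_id.dist continuous_const).min continuous_const,
      fun d x => ⟨le_min dist_nonneg zero_le_one, min_le_right _ _⟩, fun x y h => ?_⟩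
    refine eq_of_forall_dist_le fun ε hε => ?_
    obtain ⟨_, ⟨d, rfl⟩, hd⟩ := Metric.mem_closure_iff.1
      ((TopologicalSpace.denseRange_denseSeq S.carrier) x) (min (ε / 2) 1)
      (lt_min (half_pos hε) one_pos)
    have h1 : min (dist x (TopologicalSpace.denseSeq S.carrier d)) 1 =
        min (dist y (TopologicalSpace.denseSeq S.carrier d)) 1 := h d
    rw [min_eq_left (hd.le.trans (min_le_right _ _))] at h1
    have h2 := hd.trans_le (min_le_left _ _)
    have h3 := hd.trans_le (min_le_right _ _)
    have h4 : dist y (TopologicalSpace.denseSeq S.carrier d) =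
        dist x (TopologicalSpace.denseSeq S.carrier d) := by
      rcases min_choice (dist y (TopologicalSpace.denseSeq S.carrier d)) 1 with h5 | h5 <;>
        rw [h5] at h1 <;> linarith
    have := dist_triangle_right x y (TopologicalSpace.denseSeq S.carrier d)
    linarith

end Extension

section Tower

variable {G : Type} [Group G] (X : ℕ → GSystem G) (π : ∀ i, FactorMap (X i) (X (i + 1)))

/-- Observables on `X i` pulled back from the systems further down the chain. -/
def pullback (U : ∀ i, ℕ → (X i).carrier → ℝ) : (n i : ℕ) → ℕ → (X i).carrier → ℝ
  | 0, i => U i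
  | n + 1, i => fun d x => pullback U n (i + 1) d ((π i).toFun x)

variable {X} {U : ∀ i, ℕ → (X i).carrier → ℝ}

theorem continuous_pullback (hU : ∀ i d, Continuous (U i d)) (n i d : ℕ) :
    Continuous (pullback X π U n i d) := by
  induction n generalizing i with
  | zero => exact hU i d
  | succ n ih => exact (ih (i + 1)).comp (π i).cont

theorem pullback_mem_Icc (hU : ∀ i d x, U i d x ∈ Set.Icc (0 : ℝ) 1) (n i d : ℕ)
    (x : (X i).carrier) : pullback X π U n i d x ∈ Set.Icc (0 : ℝ) 1 := by
  induction n generalizing i with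
  | zero => exact hU i d x
  | succ n ih => exact ih (i + 1) _

variable [Countable G] {F : ℕ → Finset G}
  {E : Set ((G → ℝ) × (ℕ → G → ℕ × ℤ))} {box : ℕ → Finset (ℕ × ℤ)}
  (hE : IsSymbolicExt F E box) (hU : ∀ i d, Continuous (U i d))

/-- The extension of `X i` by names of all pulled back observables. -/
noncomputable def towerExt (i : ℕ) : GSystem G :=
  nameExt hE (X i) (fun j : ℕ × ℕ => pullback X π U j.1 i j.2)
    fun j => continuous_pullback π hU j.1 i j.2

/-- Forgetting the names. -/
noncomputable def towerFst (hU01 : ∀ i d x, U i d x ∈ Set.Icc (0 : ℝ) 1) (i : ℕ) :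
    FactorMap (towerExt π hE hU i) (X i) :=
  nameExtFst hE (X i) _ _ fun j x => pullback_mem_Icc π hU01 j.1 i j.2 x

theorem exists_tower_lift (hU01 : ∀ i d x, U i d x ∈ Set.Icc (0 : ℝ) 1) (i : ℕ) (x : (X i).carrier)
    (z' : (towerExt π hE hU (i + 1)).carrier) (h : (π i).toFun x = z'.1.1) :
    ∃ z : (towerExt π hE hU i).carrier, z.1.1 = x ∧ ∀ n d, z.1.2 (n + 1, d) = z'.1.2 (n, d) := by
  choose s hs using fun d => hE.exists_name (X i) (hU01 i d) x
  refine ⟨⟨(x, fun j => Nat.casesOn j.1 (s j.2) fun n => z'.1.2 (n, j.2)), ?_⟩, rfl,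
    fun _ _ => rfl⟩
  rintro ⟨_ | n, d⟩
  · exact hs d
  · have := z'.2 (n, d)
    simp only [← h, ← (π i).equiv] at this
    exact this

/-- Forgetting the names of the observables which are not pulled back from `X (i + 1)`. -/
noncomputable def towerMap (hU01 : ∀ i d x, U i d x ∈ Set.Icc (0 : ℝ) 1) (i : ℕ) :
    FactorMap (towerExt π hE hU i) (towerExt π hE hU (i + 1)) where
  toFun z := ⟨((π i).toFun z.1.1, fun j => z.1.2 (j.1 + 1, j.2)), fun j => by
    have := z.2 (j.1 + 1, j.2)
    simp only [← (π i).equiv]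
    exact this⟩
  cont := by
    refine continuous_nameExt_of_val hE _ _ _ ?_
    have hv := continuous_nameExt_val hE (X i) (fun j : ℕ × ℕ => pullback X π U j.1 i j.2)
      fun j => continuous_pullback π hU j.1 i j.2
    exact ((π i).cont.comp (continuous_fst.comp hv)).prodMk
      (continuous_pi fun j => (continuous_apply (j.1 + 1, j.2)).comp (continuous_snd.comp hv))
  surj z' := by
    obtain ⟨x, hx⟩ := (π i).surj z'.1.1
    obtain ⟨z, hz, hz'⟩ := exists_tower_lift π hE hU hU01 i x z' hx
    exact ⟨z, Subtype.ext (Prod.ext (by rw [← hx, ← hz]) (funext fun j => hz' j.1 j.2))⟩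
  equiv g z := Subtype.ext (Prod.ext ((π i).equiv g _) rfl)

theorem isTowerExt_towerMap (hU01 : ∀ i d x, U i d x ∈ Set.Icc (0 : ℝ) 1) :
    IsTowerExt π (towerMap π hE hU hU01) (towerFst π hE hU hU01) where
  comm _ _ := rfl
  lift i x z' h := by
    obtain ⟨z, hz, hz'⟩ := exists_tower_lift π hE hU hU01 i x z' h
    exact ⟨z, Subtype.ext (Prod.ext (by rw [← hz] at h; exact h) (funext fun j => hz' j.1 j.2)), hz⟩

end Tower

section Variational

open MeasureTheory

variable {G : Type} [Group G] {X Z : ℕ → GSystem G} {π : ∀ i, FactorMap (X i) (X (i + 1))}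
    {Pis : ∀ i, FactorMap (Z i) (Z (i + 1))} {ψ : ∀ i, FactorMap (Z i) (X i)}

theorem continuous_chainMap (π : ∀ i, FactorMap (X i) (X (i + 1))) (i : ℕ) :
    Continuous (chainMap X π i) := by
  induction i with
  | zero => exact continuous_id
  | succ i ih => exact (π i).cont.comp ih

theorem IsInvProb.map_chainMap {μ : Measure (X 0).carrier} (hμ : IsInvProb (X 0) μ) (i : ℕ) :
    IsInvProb (X i) (μ.map (chainMap X π i)) := by
  induction i with
  | zero =>
    rw [chainMap, Measure.map_id]
    exact hμ
  | succ i ih =>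
    have := ih.map (π i)
    rwa [Measure.map_map (π i).cont.measurable (continuous_chainMap π i).measurable] at this

theorem IsTowerExt.chainMap_comp (h : IsTowerExt π Pis ψ) (i : ℕ) :
    (ψ i).toFun ∘ chainMap Z Pis i = chainMap X π i ∘ (ψ 0).toFun := by
  induction i with
  | zero => rfl
  | succ i ih =>
    funext z
    have := congrFun ih z
    simp only [chainMap, Function.comp, h.comm] at this ⊢
    rw [this]

theorem wt_nonneg {a : ℕ → ℝ} {r : ℕ} (ha : ∀ i < r - 1, a i ∈ Set.Icc (0 : ℝ) 1) {i : ℕ}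
    (hi : i < r) : 0 ≤ wt a r i := by
  rw [wt]
  split_ifs with h0
  · exact Finset.prod_nonneg fun j hj => (ha j (Finset.mem_range.1 hj)).1
  · refine mul_nonneg (sub_nonneg.2 (ha _ (by omega)).2)
      (Finset.prod_nonneg fun j hj => (ha j (Finset.mem_Ico.1 hj).2).1)

theorem Pvar_le_of_towerExt (h : IsTowerExt π Pis ψ) {r : ℕ} {a : ℕ → ℝ}
    (ha : ∀ i < r - 1, a i ∈ Set.Icc (0 : ℝ) 1) {f : (X 0).carrier → ℝ} (hf : Continuous f)
    {Fn : ℕ → Finset G} (hent : ∀ i, ∀ ν : Measure (Z i).carrier, IsInvProb (Z i) ν →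
      mEnt (Z i) Fn ν ≤ mEnt (X i) Fn (ν.map (ψ i).toFun)) :
    Pvar Z Pis r a Fn (f ∘ (ψ 0).toFun) ≤ Pvar X π r a Fn f := by
  refine iSup_le fun ⟨ν, hν⟩ => ?_
  refine le_trans ?_ (le_iSup (fun μ : {μ : Measure (X 0).carrier // IsInvProb (X 0) μ} =>
    wSum X π r a Fn f μ.1) ⟨ν.map (ψ 0).toFun, hν.map (ψ 0)⟩)
  simp only [wSum]
  refine add_le_add (Finset.sum_le_sum fun i hi => ?_) (le_of_eq ?_)
  · refine mul_le_mul_of_nonneg_left ?_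
      (EReal.coe_nonneg.2 (wt_nonneg ha (Finset.mem_range.1 hi)))
    refine (hent i _ (hν.map_chainMap i)).trans (le_of_eq ?_)
    rw [Measure.map_map (ψ i).cont.measurable (continuous_chainMap Pis i).measurable,
      Measure.map_map (continuous_chainMap π i).measurable (ψ 0).cont.measurable,
      h.chainMap_comp i]
  · rw [integral_map (ψ 0).cont.measurable.aemeasurable hf.aestronglyMeasurable]
    rfl

end Variational

end WPP

open WPP in
/-- **Reduction to zero-dimensional systems** (Proposition 2.16): for all `G`-systems
`(X_i,G)` (`i = 1,…,r`) and factor maps `π_i : X_i → X_{i+1}`, there are zero-dimensional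
`G`-systems `(Z_i,G)` and factor maps `Π_i : Z_i → Z_{i+1}` such that for every continuous
`f : X_1 → ℝ` there exists a continuous `g : Z_1 → ℝ` with
`P^a_var(f,G,π) ≥ P^a_var(g,G,Π)` and `P^a(f,G,π) ≤ P^a(g,G,Π)`. -/
theorem zero_dimensional_reduction
    {G : Type} [Group G] [Countable G] [Infinite G]
    (Fn : ℕ → Finset G) (hFn : IsFolner G Fn)
    (X : ℕ → GSystem G) (π : ∀ i, FactorMap (X i) (X (i + 1)))
    (r : ℕ) (hr : 2 ≤ r) (a : ℕ → ℝ) (ha : ∀ i < r - 1, a i ∈ Set.Icc (0 : ℝ) 1) :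
    ∃ (Z : ℕ → GSystem G) (Pis : ∀ i, FactorMap (Z i) (Z (i + 1))),
      (∀ i < r, TotallyDisconnectedSpace (Z i).carrier) ∧
      ∀ f : (X 0).carrier → ℝ, Continuous f →
        ∃ g : (Z 0).carrier → ℝ, Continuous g ∧
          Pvar Z Pis r a Fn g ≤ Pvar X π r a Fn f ∧
          press X π r a f Fn ≤ press Z Pis r a g Fn := by
  rcases isEmpty_or_nonempty (X 0).carrier with h0 | h0
  · refine ⟨X, π, fun i _ => ?_, fun f hf => ⟨f, hf, le_rfl, le_rfl⟩⟩
    have : IsEmpty (X i).carrier := ⟨fun x => h0.elim (chainMap_surjective X π i x).choose⟩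
    infer_instance
  · obtain ⟨E, box, hE⟩ := exists_symbolicExt hFn
    choose U hU hU01 hUsep using fun i => exists_separating_observables (X i)
    have hsep : ∀ i x y, (∀ j : ℕ × ℕ, pullback X π U j.1 i j.2 x = pullback X π U j.1 i j.2 y) →
        x = y := fun i x y h => hUsep i x y fun d => h (0, d)
    have hT := isTowerExt_towerMap π hE hU hU01
    refine ⟨towerExt π hE hU, towerMap π hE hU hU01,
      fun i _ => totallyDisconnectedSpace_nameExt hE _ _ _ (hsep i), fun f hf =>
      ⟨f ∘ (towerFst π hE hU hU01 0).toFun, hf.comp (towerFst π hE hU hU01 0).cont, ?_, ?_⟩⟩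
    · exact Pvar_le_of_towerExt hT ha hf fun i ν hν =>
        mEnt_nameExt_le hE _ _ _ _ (hsep i) hν
    · exact press_le_of_towerExt hT (fun i hi => (ha i hi).1) hf Fn
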